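/- arXiv:0709.3650 — 5 statements merged into one kernel-verified Lean document; each statement's English description precedes it below -/
import Mathlib

section
/- Let ε > 0, let φ and B be C^∞ functions on [0,ε), let λ ≥ 0 and c₀ > 0, and assume φ(x) > 0 and λφ(x) + B(x) ≥ c₀ for all x ∈ [0,ε). There exists T₀ ∈ (0, ε/2] with the following property. Let 0 < T ≤ T₀ and let w be a C^∞ function on the open square Ω_T = (0,T)×(0,T) satisfying (μ+ν)² ∂_μ∂_ν w − (λ φ(2μν/(μ+ν)) + B(2μν/(μ+ν))) w = 0 on Ω_T, whose diagonal traces q₁(μ) = w(μ,μ) and q₂(μ) = (∂_μ w)(μ,μ) extend to C^∞ functions on [0,T] all of whose derivatives vanish at μ = 0. Then w extends to a C^∞ function on the closed square [0,T]×[0,T]. -/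
open MeasureTheory Set

theorem HasCompactSupport.exists_forall_iteratedDeriv_le {f : ℝ → ℝ}
    (hf : ContDiff ℝ (⊤ : ℕ∞) f) (hc : HasCompactSupport f) (n : ℕ) :
    ∃ C, 0 ≤ C ∧ ∀ x, |iteratedDeriv n f x| ≤ C := by
  obtain ⟨C, hC⟩ := (hf.continuous_iteratedFDeriv (m := n) (by exact_mod_cast le_top)
    ).bounded_above_of_compact_support (hc.iteratedFDeriv (𝕜 := ℝ) n)
  refine ⟨C, (norm_nonneg _).trans (hC 0), fun x => ?_⟩
  rw [← Real.norm_eq_abs, ← norm_iteratedFDeriv_eq_norm_iteratedDeriv]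
  exact hC x

/-- A smooth cutoff function on the line. -/
theorem exists_contDiff_cutoff {a b : ℝ} (ha : 0 ≤ a) (hab : a < b) :
    ∃ χ : ℝ → ℝ, ContDiff ℝ (⊤ : ℕ∞) χ ∧ (∀ x, |x| ≤ a → χ x = 1) ∧ ∀ x, b ≤ |x| → χ x = 0 := by
  refine ⟨fun x => Real.smoothTransition ((b ^ 2 - x ^ 2) / (b ^ 2 - a ^ 2)),
    Real.smoothTransition.contDiff.comp (by fun_prop), fun x hx => ?_, fun x hx => ?_⟩
  · have : x ^ 2 ≤ a ^ 2 := sq_le_sq' (by linarith [abs_le.1 hx]) (abs_le.1 hx).2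
    apply Real.smoothTransition.one_of_one_le
    rw [one_le_div (by nlinarith)]
    linarith
  · have : b ^ 2 ≤ x ^ 2 := by
      rw [← sq_abs x]; gcongr; linarith
    apply Real.smoothTransition.zero_of_nonpos
    exact div_nonpos_of_nonpos_of_nonneg (by linarith) (by nlinarith)

theorem exists_one_le_scaling_mul_le (c : ℝ) (k : ℕ) {M : ℕ → ℝ} (hM : ∀ n, 0 ≤ M n) :
    ∃ l : ℝ, 1 ≤ l ∧ ∀ n < k, |c * l⁻¹ ^ k / k.factorial| * (l ^ n * M n) ≤ (1 / 2) ^ k := by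
  obtain ⟨S, hS⟩ : ∃ S, S = ∑ n ∈ Finset.range k, M n := ⟨_, rfl⟩
  have hS0 : 0 ≤ S := hS ▸ Finset.sum_nonneg fun n _ => hM n
  obtain ⟨l, hl⟩ : ∃ l, l = 1 + |c| * 2 ^ k * S := ⟨_, rfl⟩
  have hl1 : 1 ≤ l := by
    have : 0 ≤ |c| * 2 ^ k * S := by positivity
    linarith
  have hlp : 0 < l := by linarith
  refine ⟨l, hl1, fun n hnk => ?_⟩
  have hMS : M n ≤ S := hS ▸ Finset.single_le_sum (fun i _ => hM i) (Finset.mem_range.2 hnk)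
  have hA : |c * l⁻¹ ^ k / k.factorial| ≤ |c| * l⁻¹ ^ k := by
    rw [abs_div, abs_mul, abs_of_pos (pow_pos (inv_pos.2 hlp) k), Nat.abs_cast]
    exact div_le_self (by positivity) (by exact_mod_cast Nat.one_le_iff_ne_zero.2 k.factorial_ne_zero)
  have hpow : l⁻¹ ^ k * l ^ n ≤ l⁻¹ := by
    obtain ⟨m, rfl⟩ : ∃ m, k = n + 1 + m := ⟨k - (n + 1), by omega⟩
    have h3 : l⁻¹ ^ n * l ^ n = 1 := by rw [← mul_pow, inv_mul_cancel₀ hlp.ne', one_pow]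
    have h4 : l⁻¹ ^ m ≤ 1 := pow_le_one₀ (by positivity) (inv_le_one_of_one_le₀ hl1)
    calc l⁻¹ ^ (n + 1 + m) * l ^ n = (l⁻¹ ^ n * l ^ n) * l⁻¹ * l⁻¹ ^ m := by ring
      _ ≤ l⁻¹ := by
        rw [h3, one_mul]
        exact mul_le_of_le_one_right (by positivity) h4
  calc |c * l⁻¹ ^ k / k.factorial| * (l ^ n * M n) ≤ (|c| * l⁻¹ ^ k) * (l ^ n * S) := by
        have := hM n
        gcongr
    _ = |c| * S * (l⁻¹ ^ k * l ^ n) := by ring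
    _ ≤ |c| * S * l⁻¹ := by gcongr
    _ ≤ (1 / 2) ^ k := by
        rw [← div_eq_mul_inv, div_le_iff₀ hlp, one_div, inv_pow, ← div_eq_inv_mul,
          le_div_iff₀ (by positivity), hl]
        linarith

/-- **Borel's lemma**: every real sequence is the sequence of derivatives at `0` of a smooth
function. -/
theorem exists_contDiff_iteratedDeriv_zero_eq (c : ℕ → ℝ) :
    ∃ g : ℝ → ℝ, ContDiff ℝ (⊤ : ℕ∞) g ∧ ∀ n, iteratedDeriv n g 0 = c n := by
  obtain ⟨χ, hχ, hχ1, hχ0⟩ := exists_contDiff_cutoff zero_le_one one_lt_two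
  obtain ⟨η, hη⟩ : ∃ η : ℕ → ℝ → ℝ, ∀ k y, η k y = y ^ k * χ y := ⟨_, fun _ _ => rfl⟩
  have hηs : ∀ k, ContDiff ℝ (⊤ : ℕ∞) (η k) := fun k => by
    rw [funext (hη k)]; fun_prop
  have hηc : ∀ k, HasCompactSupport (η k) := fun k => by
    refine HasCompactSupport.intro (isCompact_Icc (a := -2) (b := 2)) fun x hx => ?_
    have : 2 ≤ |x| := by
      by_contra! h
      exact hx ⟨by linarith [abs_lt.1 h], by linarith [abs_lt.1 h]⟩
    rw [hη, hχ0 x this, mul_zero]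
  have hη0 : ∀ n k, iteratedDeriv n (η k) 0 = if n = k then (k.factorial : ℝ) else 0 := by
    intro n k
    rw [Filter.EventuallyEq.iteratedDeriv_eq (g := fun y : ℝ => y ^ k)]
    · rw [iteratedDeriv_fun_pow_zero]
      split_ifs <;> simp
    · filter_upwards [Metric.ball_mem_nhds (0 : ℝ) one_pos] with y hy
      rw [mem_ball_zero_iff, Real.norm_eq_abs] at hy
      rw [hη, hχ1 y hy.le, mul_one]
  choose M hM0 hM using fun k n => (hηc k).exists_forall_iteratedDeriv_le (hηs k) n
  choose l hl1 hl using fun k => exists_one_le_scaling_mul_le (c k) k (hM0 k)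
  obtain ⟨A, hA⟩ : ∃ A : ℕ → ℝ, ∀ k, A k = c k * (l k)⁻¹ ^ k / k.factorial := ⟨_, fun _ => rfl⟩
  simp_rw [← hA] at hl
  obtain ⟨f, hf⟩ : ∃ f : ℕ → ℝ → ℝ, ∀ k, f k = fun x => A k * η k (l k * x) := ⟨_, fun _ => rfl⟩
  have hfs : ∀ k, ContDiff ℝ (⊤ : ℕ∞) (f k) := fun k => by
    rw [hf]
    exact contDiff_const.mul ((hηs k).comp (by fun_prop))
  have hd : ∀ k n x,
      iteratedDeriv n (f k) x = A k * (l k ^ n * iteratedDeriv n (η k) (l k * x)) := by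
    intro k n x
    rw [hf, iteratedDeriv_const_mul_field,
      iteratedDeriv_comp_const_mul ((hηs k).of_le (by exact_mod_cast le_top))]
  obtain ⟨v, hv⟩ : ∃ v : ℕ → ℕ → ℝ, ∀ n k, v n k =
    if n < k then (1 / 2) ^ k else |A k| * (l k ^ n * M k n) := ⟨_, fun _ _ => rfl⟩
  have hvs : ∀ n, Summable (v n) := fun n => by
    refine (summable_congr_atTop ?_).2 (summable_geometric_of_lt_one (r := 1 / 2) (by norm_num)
      (by norm_num))
    filter_upwards [Filter.eventually_gt_atTop n] with k hk
    rw [hv, if_pos hk]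
  have hfv : ∀ (n k : ℕ) (x : ℝ), ‖iteratedFDeriv ℝ n (f k) x‖ ≤ v n k := by
    intro n k x
    have hlp : 0 < l k := by linarith [hl1 k]
    rw [norm_iteratedFDeriv_eq_norm_iteratedDeriv, hd, Real.norm_eq_abs, abs_mul, abs_mul,
      abs_of_pos (pow_pos hlp n)]
    have h1 : |A k| * (l k ^ n * |iteratedDeriv n (η k) (l k * x)|) ≤ |A k| * (l k ^ n * M k n) := by
      gcongr
      exact hM k n _
    refine h1.trans ?_
    rw [hv]
    split_ifs with hnk
    · exact hl k n hnk
    · exact le_rfl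
  have hg : ContDiff ℝ (⊤ : ℕ∞) fun x => ∑' k, f k x :=
    contDiff_tsum hfs (fun n _ => hvs n) fun n k x _ => hfv n k x
  refine ⟨_, hg, fun n => ?_⟩
  have hsum : iteratedFDeriv ℝ n (fun x => ∑' k, f k x) 0 = ∑' k, iteratedFDeriv ℝ n (f k) 0 :=
    iteratedFDeriv_tsum_apply (N := ⊤) hfs (fun n _ => hvs n)
      (fun n k x _ => hfv n k x) (k := n) le_top 0
  have hs : Summable fun k => iteratedFDeriv ℝ n (f k) 0 :=
    .of_norm_bounded (hvs n) fun k => hfv n k 0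
  have heval : iteratedDeriv n (fun x => ∑' k, f k x) 0 =
      ∑' k, (iteratedFDeriv ℝ n (f k) 0 : (Fin n → ℝ) → ℝ) (fun _ => 1) := by
    rw [iteratedDeriv_eq_iteratedFDeriv, hsum]
    exact ContinuousMultilinearMap.tsum_eval hs _
  have hterm : ∀ k, (iteratedFDeriv ℝ n (f k) 0 : (Fin n → ℝ) → ℝ) (fun _ => 1) =
      A k * (l k ^ n * if n = k then (k.factorial : ℝ) else 0) := fun k => by
    rw [← iteratedDeriv_eq_iteratedFDeriv, hd, mul_zero, hη0]
  rw [heval, tsum_congr hterm]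
  rw [tsum_eq_single n]
  · have hlp : l n ≠ 0 := by linarith [hl1 n]
    have h1 : (l n)⁻¹ ^ n * l n ^ n = 1 := by rw [← mul_pow, inv_mul_cancel₀ hlp, one_pow]
    have h2 : (n.factorial : ℝ) ≠ 0 := by exact_mod_cast n.factorial_ne_zero
    rw [hA, if_pos rfl]
    calc _ = c n * ((l n)⁻¹ ^ n * l n ^ n) * (n.factorial / n.factorial) := by ring
      _ = c n := by rw [h1, div_self h2, mul_one, mul_one]
  · intro k hk
    rw [if_neg hk.symm, mul_zero, mul_zero]

theorem contDiff_of_hasDerivAt_succ {a : ℕ → ℝ → ℝ}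
    (h : ∀ n x, HasDerivAt (a n) (a (n + 1) x) x) : ContDiff ℝ (⊤ : ℕ∞) (a 0) := by
  have key : ∀ n, iteratedDeriv n (a 0) = a n := by
    intro n
    induction n with
    | zero => simp
    | succ n ih => rw [iteratedDeriv_succ, ih]; exact funext fun x => (h n x).deriv
  rw [contDiff_iff_iteratedDeriv]
  simp_rw [key]
  exact ⟨fun m _ => continuous_iff_continuousAt.2 fun x => (h m x).continuousAt,
    fun m _ x => (h m x).differentiableAt⟩

/-- A function that is smooth up to the boundary of a half-line extends smoothly to the line. -/
theorem ContDiffOn.exists_contDiff_eqOn_Ici {f : ℝ → ℝ}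
    (hf : ContDiffOn ℝ (⊤ : ℕ∞) f (Ici 0)) :
    ∃ g : ℝ → ℝ, ContDiff ℝ (⊤ : ℕ∞) g ∧ EqOn g f (Ici 0) := by
  obtain ⟨g, hg, hg0⟩ :=
    exists_contDiff_iteratedDeriv_zero_eq fun n => iteratedDerivWithin n f (Ici 0) 0
  set a : ℕ → ℝ → ℝ := fun n x =>
    if 0 ≤ x then iteratedDerivWithin n f (Ici 0) x else iteratedDeriv n g x with ha
  have haR : ∀ n, ∀ x ∈ Ici (0 : ℝ), a n x = iteratedDerivWithin n f (Ici 0) x := fun n x hx => by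
    simp only [ha, if_pos (mem_Ici.1 hx)]
  have haL : ∀ n, ∀ x ∈ Iic (0 : ℝ), a n x = iteratedDeriv n g x := fun n x hx => by
    rcases (mem_Iic.1 hx).lt_or_eq with h | rfl
    · simp only [ha, if_neg h.not_ge]
    · simp only [ha, le_refl, if_true, hg0]
  have hR : ∀ n, ∀ x ∈ Ici (0 : ℝ), HasDerivWithinAt (a n) (a (n + 1) x) (Ici 0) x := by
    intro n x hx
    have := (hf.differentiableOn_iteratedDerivWithin (m := n) (by exact_mod_cast ENat.natCast_lt_top n)
      (uniqueDiffOn_Ici 0) x hx).hasDerivWithinAt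
    rw [← iteratedDerivWithin_succ] at this
    rw [haR (n + 1) x hx]
    exact this.congr (haR n) (haR n x hx)
  have hL : ∀ n, ∀ x ∈ Iic (0 : ℝ), HasDerivWithinAt (a n) (a (n + 1) x) (Iic 0) x := by
    intro n x hx
    have := (hg.differentiable_iteratedDeriv n (by exact_mod_cast ENat.natCast_lt_top n) x).hasDerivAt
    rw [← iteratedDeriv_succ] at this
    rw [haL (n + 1) x hx]
    exact this.hasDerivWithinAt.congr (haL n) (haL n x hx)
  refine ⟨a 0, contDiff_of_hasDerivAt_succ fun n x => ?_, fun x hx => by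
    rw [haR 0 x hx, iteratedDerivWithin_zero]⟩
  rcases lt_trichotomy x 0 with h | rfl | h
  · exact (hL n x h.le).hasDerivAt (Iic_mem_nhds h)
  · have := (hL n 0 self_mem_Iic).union (hR n 0 self_mem_Ici)
    rwa [Iic_union_Ici, hasDerivWithinAt_univ] at this
  · exact (hR n x h.le).hasDerivAt (Ici_mem_nhds h)

theorem ContDiffOn.exists_contDiff_bounded_eqOn_Icc {f : ℝ → ℝ} {r R : ℝ} (hr : 0 ≤ r)
    (hrR : r < R) (hf : ContDiffOn ℝ (⊤ : ℕ∞) f (Ico 0 R)) :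
    ∃ g : ℝ → ℝ, ContDiff ℝ (⊤ : ℕ∞) g ∧ EqOn g f (Icc 0 r) ∧ ∃ C, ∀ x, |g x| ≤ C := by
  obtain ⟨s, hrs, hsR⟩ := exists_between hrR
  obtain ⟨χ, hχ, hχ1, hχ0⟩ := exists_contDiff_cutoff hr hrs
  have hF : ContDiffOn ℝ (⊤ : ℕ∞) (fun x => χ x * f x) (Ici 0) := by
    intro x hx
    rcases lt_or_ge x R with h | h
    · have h1 : ContDiffWithinAt ℝ (⊤ : ℕ∞) f (Ici 0) x :=
        (hf x ⟨hx, h⟩).mono_of_mem_nhdsWithin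
          (by rw [← Ici_inter_Iio]; exact inter_mem_nhdsWithin _ (Iio_mem_nhds h))
      exact hχ.contDiffWithinAt.mul h1
    · refine ContDiffAt.contDiffWithinAt ?_
      have h0 : (fun x => χ x * f x) =ᶠ[nhds x] fun _ => 0 := by
        filter_upwards [Ioi_mem_nhds (hsR.trans_le h)] with y hy
        rw [hχ0 y ((le_of_lt hy).trans (le_abs_self y)), zero_mul]
      exact contDiffAt_const.congr_of_eventuallyEq h0
  obtain ⟨g, hg, hgf⟩ := hF.exists_contDiff_eqOn_Ici
  obtain ⟨C, hC⟩ := (hχ.mul hg).continuous.bounded_above_of_compact_support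
    (HasCompactSupport.intro (isCompact_Icc (a := -s) (b := s)) fun x hx => by
      have : s ≤ |x| := by
        by_contra! h
        exact hx ⟨by linarith [abs_lt.1 h], by linarith [abs_lt.1 h]⟩
      simp [hχ0 x this])
  refine ⟨fun x => χ x * g x, hχ.mul hg, fun x hx => ?_, C, fun x => hC x⟩
  have h1 : χ x = 1 := hχ1 x (by rw [abs_of_nonneg hx.1]; exact hx.2)
  simp [hgf hx.1, h1]

/-- The linear form `v ↦ a * v.1 + b * v.2` on the plane. -/
noncomputable def gradCLM (a b : ℝ) : ℝ × ℝ →L[ℝ] ℝ :=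
  a • ContinuousLinearMap.fst ℝ ℝ ℝ + b • ContinuousLinearMap.snd ℝ ℝ ℝ

@[simp]
theorem gradCLM_apply (a b : ℝ) (v : ℝ × ℝ) : gradCLM a b v = a * v.1 + b * v.2 := by
  simp [gradCLM]

theorem gradCLM_zero : gradCLM 0 0 = 0 := by
  ext <;> simp

/-- The integral of `f` along the vertical segment from the diagonal to `p` at abscissa `p.1`. -/
noncomputable def vertInt (f : ℝ × ℝ → ℝ) (p : ℝ × ℝ) : ℝ := ∫ b in p.1..p.2, f (p.1, b)

/-- The integral of `f` along the horizontal segment from the diagonal to `p` at height `p.2`. -/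
noncomputable def horInt (f : ℝ × ℝ → ℝ) (p : ℝ × ℝ) : ℝ := ∫ a in p.1..p.2, f (a, p.2)

/-- The signed integral of `f` over the characteristic triangle cut out by `p` and the diagonal. -/
noncomputable def triInt (f : ℝ × ℝ → ℝ) (p : ℝ × ℝ) : ℝ :=
  ∫ b in p.1..p.2, ∫ a in p.1..b, f (a, b)

theorem horInt_eq_neg_vertInt_swap (f : ℝ × ℝ → ℝ) :
    horInt f = fun p => -vertInt (fun q => f q.swap) p.swap := by
  ext p
  simp only [horInt, vertInt, Prod.swap]
  rw [intervalIntegral.integral_symm]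

theorem continuous_primitive_vert {g : ℝ × ℝ → ℝ} (hg : Continuous g) :
    Continuous fun p : ℝ × ℝ => ∫ b in (0 : ℝ)..p.2, g (p.1, b) :=
  intervalIntegral.continuous_parametric_primitive_of_continuous (f := fun x b => g (x, b)) hg

theorem continuous_primitive_hor {g : ℝ × ℝ → ℝ} (hg : Continuous g) :
    Continuous fun p : ℝ × ℝ => ∫ a in (0 : ℝ)..p.1, g (a, p.2) :=
  (continuous_primitive_vert (hg.comp continuous_swap)).comp continuous_swap

theorem hasFDerivAt_primitive_vert {g g₁ : ℝ × ℝ → ℝ} (hg : Continuous g) (hg₁ : Continuous g₁)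
    (h : ∀ p : ℝ × ℝ, HasDerivAt (fun x => g (x, p.2)) (g₁ p) p.1) (p : ℝ × ℝ) :
    HasFDerivAt (fun p : ℝ × ℝ => ∫ b in (0 : ℝ)..p.2, g (p.1, b))
      (gradCLM (∫ b in (0 : ℝ)..p.2, g₁ (p.1, b)) (g p)) p := by
  have key := hasStrictFDerivAt_uncurry_coprod (𝕜 := ℝ) (u := p)
    (f := fun x z => ∫ b in (0 : ℝ)..z, g (x, b))
    (f₁ := fun x z => ContinuousLinearMap.toSpanSingleton ℝ (∫ b in (0 : ℝ)..z, g₁ (x, b)))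
    (f₂ := fun x z => ContinuousLinearMap.toSpanSingleton ℝ (g (x, z))) ?_ ?_ ?_ ?_
  · refine key.hasFDerivAt.congr_fderiv ?_
    ext <;> simp [Function.HasUncurry.uncurry]
  · refine Filter.Eventually.of_forall fun v => ?_
    obtain ⟨x₀, z⟩ := v
    obtain ⟨C, hC⟩ := ((isCompact_closedBall x₀ 1).prod (isCompact_uIcc (a := 0) (b := z))
      ).exists_bound_of_continuousOn hg₁.continuousOn
    exact (intervalIntegral.hasDerivAt_integral_of_dominated_loc_of_deriv_le (μ := volume)
      (F := fun x b => g (x, b)) (F' := fun x b => g₁ (x, b)) (bound := fun _ => C)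
      (Metric.closedBall_mem_nhds x₀ one_pos)
      (.of_forall fun x => (by fun_prop : Continuous fun b => g (x, b)).aestronglyMeasurable)
      ((by fun_prop : Continuous fun b => g (x₀, b)).intervalIntegrable _ _)
      (by fun_prop : Continuous fun b => g₁ (x₀, b)).aestronglyMeasurable
      (.of_forall fun b hb x hx => hC (x, b) ⟨hx, uIoc_subset_uIcc hb⟩)
      intervalIntegrable_const
      (.of_forall fun b _ x _ => h (x, b))).2.hasFDerivAt
  · refine Filter.Eventually.of_forall fun v => ?_
    exact (intervalIntegral.integral_hasDerivAt_right
      ((by fun_prop : Continuous fun b => g (v.1, b)).intervalIntegrable _ _)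
      ((by fun_prop : Continuous fun b => g (v.1, b)).stronglyMeasurableAtFilter _ _)
      (by fun_prop : Continuous fun b => g (v.1, b)).continuousAt).hasFDerivAt
  · refine Continuous.continuousAt ?_
    exact ((ContinuousLinearMap.toSpanSingletonCLE (𝕜 := ℝ) (E := ℝ)).continuous.comp
      (continuous_primitive_vert hg₁))
  · refine Continuous.continuousAt ?_
    exact ((ContinuousLinearMap.toSpanSingletonCLE (𝕜 := ℝ) (E := ℝ)).continuous.comp hg)

theorem vertInt_eq_sub {g : ℝ × ℝ → ℝ} (hg : Continuous g) (p : ℝ × ℝ) :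
    vertInt g p = (∫ b in (0 : ℝ)..p.2, g (p.1, b)) - ∫ b in (0 : ℝ)..p.1, g (p.1, b) := by
  have hc : Continuous fun b => g (p.1, b) := by fun_prop
  exact (intervalIntegral.integral_interval_sub_left (hc.intervalIntegrable _ _)
    (hc.intervalIntegrable _ _)).symm

theorem horInt_eq_sub {g : ℝ × ℝ → ℝ} (hg : Continuous g) (p : ℝ × ℝ) :
    horInt g p = (∫ a in (0 : ℝ)..p.2, g (a, p.2)) - ∫ a in (0 : ℝ)..p.1, g (a, p.2) := by
  have hc : Continuous fun a => g (a, p.2) := by fun_prop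
  exact (intervalIntegral.integral_interval_sub_left (hc.intervalIntegrable _ _)
    (hc.intervalIntegrable _ _)).symm

theorem continuous_vertInt {g : ℝ × ℝ → ℝ} (hg : Continuous g) : Continuous (vertInt g) := by
  rw [funext (vertInt_eq_sub hg)]
  exact (continuous_primitive_vert hg).sub
    ((continuous_primitive_vert hg).comp (continuous_fst.prodMk continuous_fst))

theorem hasFDerivAt_vertInt {g g₁ : ℝ × ℝ → ℝ} (hg : Continuous g) (hg₁ : Continuous g₁)
    (h : ∀ p : ℝ × ℝ, HasDerivAt (fun x => g (x, p.2)) (g₁ p) p.1) (p : ℝ × ℝ) :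
    HasFDerivAt (vertInt g) (gradCLM (vertInt g₁ p - g (p.1, p.1)) (g p)) p := by
  have h1 := hasFDerivAt_primitive_vert hg hg₁ h p
  have h2 := (hasFDerivAt_primitive_vert hg hg₁ h (p.1, p.1)).comp p
    ((ContinuousLinearMap.fst ℝ ℝ ℝ).prod (ContinuousLinearMap.fst ℝ ℝ ℝ)).hasFDerivAt
  rw [funext (vertInt_eq_sub hg)]
  refine (h1.sub h2).congr_fderiv ?_
  ext
  · simp [vertInt_eq_sub hg₁]; ring
  · simp

theorem triInt_eq_sub {f : ℝ × ℝ → ℝ} (hf : Continuous f) (p : ℝ × ℝ) :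
    triInt f p = ((∫ b in (0 : ℝ)..p.2, ∫ a in (0 : ℝ)..b, f (a, b))
      - ∫ b in (0 : ℝ)..p.1, ∫ a in (0 : ℝ)..b, f (a, b))
      - vertInt (fun q => ∫ a in (0 : ℝ)..q.1, f (a, q.2)) p := by
  have hG := continuous_primitive_hor hf
  have hd : Continuous fun b : ℝ => ∫ a in (0 : ℝ)..b, f (a, b) :=
    hG.comp (continuous_id.prodMk continuous_id)
  have hv : Continuous fun b : ℝ => ∫ a in (0 : ℝ)..p.1, f (a, b) :=
    hG.comp (continuous_const.prodMk continuous_id)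
  rw [intervalIntegral.integral_interval_sub_left (hd.intervalIntegrable _ _)
    (hd.intervalIntegrable _ _), vertInt, triInt,
    ← intervalIntegral.integral_sub (hd.intervalIntegrable _ _) (hv.intervalIntegrable _ _)]
  refine intervalIntegral.integral_congr fun b _ => ?_
  have hc : Continuous fun a => f (a, b) := by fun_prop
  exact (intervalIntegral.integral_interval_sub_left (hc.intervalIntegrable _ _)
    (hc.intervalIntegrable _ _)).symm

theorem hasFDerivAt_triInt {f : ℝ × ℝ → ℝ} (hf : Continuous f) (p : ℝ × ℝ) :
    HasFDerivAt (triInt f) (gradCLM (-vertInt f p) (horInt f p)) p := by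
  have hG := continuous_primitive_hor hf
  have hd : Continuous fun b : ℝ => ∫ a in (0 : ℝ)..b, f (a, b) :=
    hG.comp (continuous_id.prodMk continuous_id)
  have hD : ∀ x, HasDerivAt (fun x => ∫ b in (0 : ℝ)..x, ∫ a in (0 : ℝ)..b, f (a, b))
      (∫ a in (0 : ℝ)..x, f (a, x)) x := fun x =>
    intervalIntegral.integral_hasDerivAt_right (hd.intervalIntegrable _ _)
      (hd.stronglyMeasurableAtFilter _ _) hd.continuousAt
  have hV := hasFDerivAt_vertInt hG hf (fun q => by
    have hc : Continuous fun a => f (a, q.2) := by fun_prop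
    exact intervalIntegral.integral_hasDerivAt_right (hc.intervalIntegrable _ _)
      (hc.stronglyMeasurableAtFilter _ _) hc.continuousAt) p
  have h1 := (hD p.1).hasFDerivAt.comp p hasFDerivAt_fst
  have h2 := (hD p.2).hasFDerivAt.comp p hasFDerivAt_snd
  rw [funext (triInt_eq_sub hf)]
  refine ((h2.sub h1).sub hV).congr_fderiv ?_
  ext
  · simp
    ring
  · simp [horInt_eq_sub hf]

theorem continuous_triInt {f : ℝ × ℝ → ℝ} (hf : Continuous f) : Continuous (triInt f) :=
  continuous_iff_continuousAt.2 fun p => (hasFDerivAt_triInt hf p).continuousAt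

theorem triInt_sub_of_intervalIntegrable {f g : ℝ × ℝ → ℝ} (p : ℝ × ℝ)
    (hf : ∀ b ∈ uIcc p.1 p.2, IntervalIntegrable (fun a => f (a, b)) volume p.1 b)
    (hg : ∀ b ∈ uIcc p.1 p.2, IntervalIntegrable (fun a => g (a, b)) volume p.1 b)
    (hf' : IntervalIntegrable (fun b => horInt f (p.1, b)) volume p.1 p.2)
    (hg' : IntervalIntegrable (fun b => horInt g (p.1, b)) volume p.1 p.2) :
    triInt (fun q => f q - g q) p = triInt f p - triInt g p := by
  refine Eq.trans ?_ (intervalIntegral.integral_sub hf' hg')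
  exact intervalIntegral.integral_congr fun b hb => intervalIntegral.integral_sub (hf b hb) (hg b hb)

theorem continuous_horInt {g : ℝ × ℝ → ℝ} (hg : Continuous g) : Continuous (horInt g) := by
  rw [horInt_eq_neg_vertInt_swap]
  exact ((continuous_vertInt (hg.comp continuous_swap)).comp continuous_swap).neg

theorem triInt_sub {f g : ℝ × ℝ → ℝ} (hf : Continuous f) (hg : Continuous g) (p : ℝ × ℝ) :
    triInt (fun q => f q - g q) p = triInt f p - triInt g p := by
  have hin : ∀ h : ℝ × ℝ → ℝ, Continuous h → ∀ b,
      IntervalIntegrable (fun a => h (a, b)) volume p.1 b := fun h hh b =>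
    (by fun_prop : Continuous fun a => h (a, b)).intervalIntegrable _ _
  have hout : ∀ h : ℝ × ℝ → ℝ, Continuous h →
      IntervalIntegrable (fun b => horInt h (p.1, b)) volume p.1 p.2 := fun h hh =>
    ((continuous_horInt hh).comp (continuous_const.prodMk continuous_id)).intervalIntegrable _ _
  exact triInt_sub_of_intervalIntegrable p (fun b _ => hin f hf b) (fun b _ => hin g hg b)
    (hout f hf) (hout g hg)

theorem abs_le_norm_of_mem_uIcc {p : ℝ × ℝ} {a : ℝ} (ha : a ∈ uIcc p.1 p.2) : |a| ≤ ‖p‖ := by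
  rw [Prod.norm_def, Real.norm_eq_abs, Real.norm_eq_abs]
  rcases le_total p.1 p.2 with h | h
  · rw [uIcc_of_le h] at ha
    exact abs_le_max_abs_abs ha.1 ha.2
  · rw [uIcc_of_ge h] at ha
    rw [max_comm]
    exact abs_le_max_abs_abs ha.1 ha.2

theorem norm_le_norm_of_mem_uIcc {p : ℝ × ℝ} {a b : ℝ} (ha : a ∈ uIcc p.1 p.2)
    (hb : b ∈ uIcc p.1 p.2) : ‖(a, b)‖ ≤ ‖p‖ :=
  norm_prod_le_iff.2 ⟨abs_le_norm_of_mem_uIcc ha, abs_le_norm_of_mem_uIcc hb⟩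

theorem abs_intervalIntegral_le_of_le {f g : ℝ → ℝ} {x y r : ℝ} (hx : |x| ≤ r) (hy : |y| ≤ r)
    (hg : Continuous g) (hg0 : ∀ t, 0 ≤ g t) (h : ∀ t ∈ uIcc x y, |f t| ≤ g t) :
    |∫ t in x..y, f t| ≤ ∫ t in (-r)..r, g t := by
  have hr : -r ≤ r := by linarith [(abs_nonneg x).trans hx]
  have h1 : ‖∫ t in x..y, f t‖ ≤ |∫ t in x..y, g t| :=
    intervalIntegral.norm_integral_le_abs_of_norm_le
      ((ae_restrict_mem measurableSet_uIoc).mono fun t ht => h t (uIoc_subset_uIcc ht))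
      (hg.intervalIntegrable _ _)
  rw [← Real.norm_eq_abs]
  refine h1.trans ((intervalIntegral.abs_integral_mono_interval ?_ (.of_forall hg0)
    (hg.intervalIntegrable _ _)).trans (abs_of_nonneg ?_).le)
  · rw [uIoc, uIoc_of_le hr]
    exact Ioc_subset_Ioc (le_min (abs_le.1 hx).1 (abs_le.1 hy).1)
      (max_le (abs_le.1 hx).2 (abs_le.1 hy).2)
  · exact intervalIntegral.integral_nonneg hr fun t _ => hg0 t

theorem integral_even_pow_symm (r : ℝ) (m : ℕ) :
    ∫ t in (-r)..r, t ^ (2 * m) = 2 * r ^ (2 * m + 1) / (2 * m + 1) := by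
  rw [integral_pow, Odd.neg_pow ⟨m, rfl⟩]
  push_cast
  ring

/-- Integrating a function of size `‖·‖ ^ (2 * m)` over a characteristic triangle gains two powers
and a factor tending to zero as `m → ∞`. -/
theorem abs_triInt_le {f : ℝ × ℝ → ℝ} {p : ℝ × ℝ} {C : ℝ} (hC : 0 ≤ C) (m : ℕ)
    (h : ∀ a ∈ uIcc p.1 p.2, ∀ b ∈ uIcc p.1 p.2, |f (a, b)| ≤ C * ‖(a, b)‖ ^ (2 * m)) :
    |triInt f p| ≤ 8 * C / (2 * m + 1) * ‖p‖ ^ (2 * m + 2) := by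
  obtain ⟨r, hr⟩ : ∃ r, r = ‖p‖ := ⟨_, rfl⟩
  have hr0 : 0 ≤ r := hr ▸ norm_nonneg p
  have hle : ∀ t ∈ uIcc p.1 p.2, |t| ≤ r := fun t ht => hr ▸ abs_le_norm_of_mem_uIcc ht
  have hpt : ∀ a b : ℝ, ‖(a, b)‖ ^ (2 * m) ≤ a ^ (2 * m) + b ^ (2 * m) := by
    intro a b
    have ha : 0 ≤ a ^ (2 * m) := (even_two_mul m).pow_nonneg a
    have hb : 0 ≤ b ^ (2 * m) := (even_two_mul m).pow_nonneg b
    rw [Prod.norm_def, Real.norm_eq_abs, Real.norm_eq_abs]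
    rcases max_choice |a| |b| with h | h <;> rw [h, (even_two_mul m).pow_abs] <;> linarith
  have hin : ∀ b ∈ uIcc p.1 p.2, |∫ a in p.1..b, f (a, b)| ≤
      C * (2 * r ^ (2 * m + 1) / (2 * m + 1) + 2 * r * b ^ (2 * m)) := by
    intro b hb
    have hb0 : 0 ≤ b ^ (2 * m) := (even_two_mul m).pow_nonneg b
    refine (abs_intervalIntegral_le_of_le (g := fun a => C * (a ^ (2 * m) + b ^ (2 * m)))
      (hle _ left_mem_uIcc) (hle b hb) (by fun_prop) (fun a => ?_) fun a ha => ?_).trans_eq ?_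
    · have := (even_two_mul m).pow_nonneg a
      positivity
    · refine (h a (uIcc_subset_uIcc_left hb ha) b hb).trans ?_
      gcongr
      exact hpt a b
    · rw [intervalIntegral.integral_const_mul, intervalIntegral.integral_add
        ((continuous_pow _).intervalIntegrable _ _) intervalIntegrable_const,
        integral_even_pow_symm, intervalIntegral.integral_const, smul_eq_mul]
      ring
  refine (abs_intervalIntegral_le_of_le
    (g := fun b => C * (2 * r ^ (2 * m + 1) / (2 * m + 1) + 2 * r * b ^ (2 * m)))
      (hle _ left_mem_uIcc) (hle _ right_mem_uIcc) (by fun_prop) (fun b => ?_) hin).trans_eq ?_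
  · have := (even_two_mul m).pow_nonneg b
    positivity
  · rw [intervalIntegral.integral_const_mul, intervalIntegral.integral_add
      intervalIntegrable_const (((continuous_pow _).const_mul _).intervalIntegrable _ _),
      intervalIntegral.integral_const_mul, integral_even_pow_symm,
      intervalIntegral.integral_const, smul_eq_mul, ← hr]
    ring

/-- `f` is continuous on the plane and vanishes to infinite order at the origin. -/
def FlatBound (f : ℝ × ℝ → ℝ) : Prop :=
  Continuous f ∧ ∀ (N : ℕ) (R : ℝ), ∃ C, 0 ≤ C ∧ ∀ p, ‖p‖ ≤ R → |f p| ≤ C * ‖p‖ ^ N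

/-- `f` has `k` continuous derivatives, all of which vanish to infinite order at the origin. -/
def IsFlat : ℕ → (ℝ × ℝ → ℝ) → Prop
  | 0, f => FlatBound f
  | k + 1, f => FlatBound f ∧ ∃ f₁ f₂, IsFlat k f₁ ∧ IsFlat k f₂ ∧
      ∀ p, HasFDerivAt f (gradCLM (f₁ p) (f₂ p)) p

/-- `m` is continuous off the origin, with at most polynomial growth there. -/
def MultBound (m : ℝ × ℝ → ℝ) : Prop :=
  ContinuousOn m {0}ᶜ ∧
    ∀ R : ℝ, ∃ (C : ℝ) (q : ℕ), 0 ≤ C ∧ ∀ p, p ≠ 0 → ‖p‖ ≤ R → |m p| * ‖p‖ ^ q ≤ C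

/-- `m` has `k` continuous derivatives off the origin, with at most polynomial growth there. -/
def IsMult : ℕ → (ℝ × ℝ → ℝ) → Prop
  | 0, m => MultBound m
  | k + 1, m => MultBound m ∧ ∃ m₁ m₂, IsMult k m₁ ∧ IsMult k m₂ ∧
      ∀ p, p ≠ 0 → HasFDerivAt m (gradCLM (m₁ p) (m₂ p)) p

section Flat

variable {f g : ℝ × ℝ → ℝ} {k : ℕ}

theorem FlatBound.apply_zero (hf : FlatBound f) : f 0 = 0 := by
  obtain ⟨C, -, hC⟩ := hf.2 1 0
  simpa using hC 0 (by simp)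

theorem FlatBound.continuous (hf : FlatBound f) : Continuous f :=
  hf.1

theorem FlatBound.of_bound (hf : Continuous f)
    (h : ∀ (N : ℕ) (R : ℝ), 0 ≤ R → ∃ C M, 0 ≤ C ∧ N ≤ M ∧ ∀ p, ‖p‖ ≤ R → |f p| ≤ C * ‖p‖ ^ M) :
    FlatBound f := by
  refine ⟨hf, fun N R => ?_⟩
  obtain ⟨C, M, hC, hM, hb⟩ := h N |R| (abs_nonneg R)
  refine ⟨C * |R| ^ (M - N), by positivity, fun p hp => ?_⟩
  have hp' := hp.trans (le_abs_self R)
  calc |f p| ≤ C * (‖p‖ ^ (M - N) * ‖p‖ ^ N) := by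
        rw [← pow_add, Nat.sub_add_cancel hM]; exact hb p hp'
    _ ≤ C * (|R| ^ (M - N) * ‖p‖ ^ N) := by gcongr
    _ = _ := by ring

theorem FlatBound.zero : FlatBound fun _ => 0 :=
  ⟨continuous_const, fun _ _ => ⟨0, le_rfl, by simp⟩⟩

theorem FlatBound.add (hf : FlatBound f) (hg : FlatBound g) : FlatBound fun p => f p + g p := by
  refine ⟨hf.1.add hg.1, fun N R => ?_⟩
  obtain ⟨C, hC, hCf⟩ := hf.2 N R
  obtain ⟨D, hD, hDg⟩ := hg.2 N R
  refine ⟨C + D, by positivity, fun p hp => (abs_add_le _ _).trans ?_⟩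
  linarith [hCf p hp, hDg p hp]

theorem FlatBound.const_mul (c : ℝ) (hf : FlatBound f) : FlatBound fun p => c * f p := by
  refine ⟨hf.1.const_mul c, fun N R => ?_⟩
  obtain ⟨C, hC, hCf⟩ := hf.2 N R
  refine ⟨|c| * C, by positivity, fun p hp => ?_⟩
  rw [abs_mul, mul_assoc]
  gcongr
  exact hCf p hp

theorem FlatBound.comp_clm (hf : FlatBound f) (L : ℝ × ℝ →L[ℝ] ℝ × ℝ) (hL : ∀ p, ‖L p‖ ≤ ‖p‖) :
    FlatBound fun p => f (L p) := by
  refine ⟨hf.1.comp L.continuous, fun N R => ?_⟩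
  obtain ⟨C, hC, hCf⟩ := hf.2 N R
  refine ⟨C, hC, fun p hp => (hCf _ ((hL p).trans hp)).trans ?_⟩
  gcongr
  exact hL p

theorem FlatBound.vertInt (hf : FlatBound f) : FlatBound (vertInt f) := by
  refine ⟨continuous_vertInt hf.1, fun N R => ?_⟩
  obtain ⟨C, hC, hCf⟩ := hf.2 N R
  refine ⟨C * (2 * |R|), by positivity, fun p hp => ?_⟩
  have h1 : ‖∫ b in p.1..p.2, f (p.1, b)‖ ≤ C * ‖p‖ ^ N * |p.2 - p.1| := by
    refine intervalIntegral.norm_integral_le_of_norm_le_const fun b hb => ?_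
    have := norm_le_norm_of_mem_uIcc left_mem_uIcc (uIoc_subset_uIcc hb)
    refine (hCf _ (this.trans hp)).trans ?_
    gcongr
  have h2 : |p.2 - p.1| ≤ 2 * |R| := by
    have h3 := (norm_fst_le p).trans (hp.trans (le_abs_self R))
    have h4 := (norm_snd_le p).trans (hp.trans (le_abs_self R))
    rw [Real.norm_eq_abs] at h3 h4
    linarith [abs_sub p.2 p.1]
  calc |_root_.vertInt f p| ≤ C * ‖p‖ ^ N * |p.2 - p.1| := h1
    _ ≤ C * ‖p‖ ^ N * (2 * |R|) := by gcongr
    _ = _ := by ring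

theorem FlatBound.triInt (hf : FlatBound f) : FlatBound (triInt f) := by
  refine FlatBound.of_bound (continuous_triInt hf.1) fun N R _ => ?_
  obtain ⟨C, hC, hCf⟩ := hf.2 (2 * N) R
  refine ⟨8 * C / (2 * N + 1), 2 * N + 2, by positivity, by omega, fun p hp => ?_⟩
  exact abs_triInt_le hC N fun a ha b hb => hCf _ ((norm_le_norm_of_mem_uIcc ha hb).trans hp)

theorem IsFlat.flatBound (hf : IsFlat k f) : FlatBound f := by
  cases k with
  | zero => exact hf
  | succ k => exact hf.1

theorem IsFlat.of_succ : ∀ {k : ℕ} {f : ℝ × ℝ → ℝ}, IsFlat (k + 1) f → IsFlat k f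
  | 0, _, hf => hf.1
  | _ + 1, _, ⟨h0, f₁, f₂, h1, h2, hd⟩ => ⟨h0, f₁, f₂, h1.of_succ, h2.of_succ, hd⟩

theorem IsFlat.zero : ∀ k : ℕ, IsFlat k fun _ => 0
  | 0 => FlatBound.zero
  | k + 1 => ⟨FlatBound.zero, fun _ => 0, fun _ => 0, IsFlat.zero k, IsFlat.zero k, fun p => by
      rw [gradCLM_zero]; exact hasFDerivAt_const 0 p⟩

theorem IsFlat.add : ∀ {k : ℕ} {f g : ℝ × ℝ → ℝ}, IsFlat k f → IsFlat k g →
    IsFlat k fun p => f p + g p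
  | 0, _, _, hf, hg => FlatBound.add hf hg
  | _ + 1, _, _, ⟨h0, _, _, h1, h2, hd⟩, ⟨h0', _, _, h1', h2', hd'⟩ =>
    ⟨h0.add h0', _, _, h1.add h1', h2.add h2', fun p =>
      ((hd p).add (hd' p)).congr_fderiv (by ext <;> simp)⟩

theorem IsFlat.const_mul (c : ℝ) : ∀ {k : ℕ} {f : ℝ × ℝ → ℝ}, IsFlat k f →
    IsFlat k fun p => c * f p
  | 0, _, hf => FlatBound.const_mul c hf
  | _ + 1, _, ⟨h0, _, _, h1, h2, hd⟩ =>
    ⟨h0.const_mul c, _, _, h1.const_mul c, h2.const_mul c, fun p =>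
      ((hd p).const_mul c).congr_fderiv (by ext <;> simp)⟩

theorem IsFlat.neg (hf : IsFlat k f) : IsFlat k fun p => -f p := by
  simpa using hf.const_mul (-1)

theorem IsFlat.sub (hf : IsFlat k f) (hg : IsFlat k g) : IsFlat k fun p => f p - g p := by
  simpa [sub_eq_add_neg] using hf.add hg.neg

theorem IsFlat.comp_clm (L : ℝ × ℝ →L[ℝ] ℝ × ℝ) (hL : ∀ p, ‖L p‖ ≤ ‖p‖) :
    ∀ {k : ℕ} {f : ℝ × ℝ → ℝ}, IsFlat k f → IsFlat k fun p => f (L p)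
  | 0, _, hf => FlatBound.comp_clm hf L hL
  | _ + 1, _, ⟨h0, f₁, f₂, h1, h2, hd⟩ =>
    ⟨h0.comp_clm L hL,
      fun p => (L (1, 0)).1 * f₁ (L p) + (L (1, 0)).2 * f₂ (L p),
      fun p => (L (0, 1)).1 * f₁ (L p) + (L (0, 1)).2 * f₂ (L p),
      ((h1.comp_clm L hL).const_mul _).add ((h2.comp_clm L hL).const_mul _),
      ((h1.comp_clm L hL).const_mul _).add ((h2.comp_clm L hL).const_mul _), fun p =>
      ((hd (L p)).comp p L.hasFDerivAt).congr_fderiv (by ext <;> simp <;> ring)⟩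

theorem IsFlat.comp_swap (hf : IsFlat k f) : IsFlat k fun p => f p.swap :=
  hf.comp_clm ((ContinuousLinearMap.snd ℝ ℝ ℝ).prod (ContinuousLinearMap.fst ℝ ℝ ℝ)) fun p => by
    simp [Prod.norm_def, max_comm]

theorem IsFlat.vertInt : ∀ {k : ℕ} {f : ℝ × ℝ → ℝ}, IsFlat k f → IsFlat k (vertInt f)
  | 0, _, hf => FlatBound.vertInt hf
  | k + 1, f, ⟨h0, f₁, f₂, h1, h2, hd⟩ => by
    have hf : IsFlat (k + 1) f := ⟨h0, f₁, f₂, h1, h2, hd⟩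
    refine ⟨h0.vertInt, _, _, h1.vertInt.sub (hf.of_succ.comp_clm
      ((ContinuousLinearMap.fst ℝ ℝ ℝ).prod (ContinuousLinearMap.fst ℝ ℝ ℝ)) fun p => ?_),
      hf.of_succ, fun p => hasFDerivAt_vertInt h0.1 h1.flatBound.1 (fun q => ?_) p⟩
    · simpa using norm_fst_le p
    · have hl : HasDerivAt (fun x : ℝ => (x, q.2)) ((1 : ℝ), (0 : ℝ)) q.1 :=
        (hasDerivAt_id q.1).prodMk (hasDerivAt_const q.1 q.2)
      exact ((hd q).comp_hasDerivAt q.1 hl).congr_deriv (by simp)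

theorem IsFlat.horInt (hf : IsFlat k f) : IsFlat k (horInt f) := by
  rw [horInt_eq_neg_vertInt_swap]
  exact hf.comp_swap.vertInt.comp_swap.neg

theorem IsFlat.triInt (hf : IsFlat k f) : IsFlat (k + 1) (triInt f) :=
  ⟨hf.flatBound.triInt, _, _, hf.vertInt.neg, hf.horInt, hasFDerivAt_triInt hf.flatBound.1⟩

theorem IsFlat.contDiff : ∀ {k : ℕ} {f : ℝ × ℝ → ℝ}, IsFlat k f → ContDiff ℝ k f
  | 0, _, hf => by simpa using FlatBound.continuous hf
  | k + 1, _, ⟨_, f₁, f₂, h1, h2, hd⟩ => by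
    push_cast
    refine contDiff_succ_iff_hasFDerivAt.2 ⟨fun p => gradCLM (f₁ p) (f₂ p), ?_, hd⟩
    exact (h1.contDiff.smul contDiff_const).add (h2.contDiff.smul contDiff_const)

end Flat

theorem exists_abs_le_mul_abs_pow_of_iteratedDeriv_eq_zero (R : ℝ) (N : ℕ) :
    ∀ {F : ℝ → ℝ}, ContDiff ℝ (⊤ : ℕ∞) F → (∀ i, iteratedDeriv i F 0 = 0) →
      ∃ C, 0 ≤ C ∧ ∀ x, |x| ≤ R → |F x| ≤ C * |x| ^ N := by
  induction N with
  | zero =>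
    intro F hF _
    obtain ⟨C, hC⟩ := (isCompact_Icc (a := -R) (b := R)).exists_bound_of_continuousOn
      hF.continuous.continuousOn
    refine ⟨|C|, abs_nonneg C, fun x hx => ?_⟩
    simpa using (hC x (abs_le.1 hx)).trans (le_abs_self C)
  | succ N ih =>
    intro F hF h0
    have hF' : ContDiff ℝ (⊤ : ℕ∞) (deriv F) := by
      simpa using (contDiff_infty_iff_deriv.1 hF).2
    obtain ⟨C, hC, hb⟩ := ih hF' fun i => by rw [← iteratedDeriv_succ']; exact h0 (i + 1)
    refine ⟨C, hC, fun x hx => ?_⟩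
    have h := (convex_Icc (-|x|) |x|).norm_image_sub_le_of_norm_deriv_le (f := F)
      (C := C * |x| ^ N) (x := 0) (y := x)
      (fun y _ => (hF.differentiable (by simp)).differentiableAt) (fun y hy => ?_) (by simp)
      (abs_le.1 le_rfl)
    · have hF0 : F 0 = 0 := by simpa using h0 0
      simpa [hF0, pow_succ, mul_assoc] using h
    · have hy' : |y| ≤ |x| := abs_le.2 hy
      refine (hb y (hy'.trans hx)).trans ?_
      gcongr

theorem IsFlat.comp_fst : ∀ (k : ℕ) {F : ℝ → ℝ}, ContDiff ℝ (⊤ : ℕ∞) F →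
    (∀ i, iteratedDeriv i F 0 = 0) → IsFlat k fun p => F p.1 := by
  have hb : ∀ {F : ℝ → ℝ}, ContDiff ℝ (⊤ : ℕ∞) F → (∀ i, iteratedDeriv i F 0 = 0) →
      FlatBound fun p => F p.1 := by
    intro F hF h0
    refine ⟨hF.continuous.comp continuous_fst, fun N R => ?_⟩
    obtain ⟨C, hC, hCF⟩ := exists_abs_le_mul_abs_pow_of_iteratedDeriv_eq_zero R N hF h0
    refine ⟨C, hC, fun p hp => ?_⟩
    have := norm_fst_le p
    refine (hCF p.1 (this.trans hp)).trans ?_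
    gcongr
    exact this
  intro k
  induction k with
  | zero => exact hb
  | succ k ih =>
    intro F hF h0
    have hF' : ContDiff ℝ (⊤ : ℕ∞) (deriv F) := by
      simpa using (contDiff_infty_iff_deriv.1 hF).2
    refine ⟨hb hF h0, fun p => deriv F p.1, fun _ => 0, ih hF' fun i => ?_, IsFlat.zero k,
      fun p => ?_⟩
    · rw [← iteratedDeriv_succ']; exact h0 (i + 1)
    · exact ((hF.differentiable (by simp)).differentiableAt.hasDerivAt.hasFDerivAt.comp p
        hasFDerivAt_fst).congr_fderiv (by ext <;> simp)

section Mult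

variable {f m n : ℝ × ℝ → ℝ} {k : ℕ}

theorem MultBound.add (hm : MultBound m) (hn : MultBound n) : MultBound fun p => m p + n p := by
  refine ⟨hm.1.add hn.1, fun R => ?_⟩
  obtain ⟨C, q, hC, hb⟩ := hm.2 R
  obtain ⟨D, r, hD, hb'⟩ := hn.2 R
  refine ⟨C * |R| ^ r + D * |R| ^ q, q + r, by positivity, fun p h0 hp => ?_⟩
  have hp' := hp.trans (le_abs_self R)
  calc |m p + n p| * ‖p‖ ^ (q + r) ≤ (|m p| + |n p|) * ‖p‖ ^ (q + r) := by
        gcongr; exact abs_add_le _ _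
    _ = (|m p| * ‖p‖ ^ q) * ‖p‖ ^ r + (|n p| * ‖p‖ ^ r) * ‖p‖ ^ q := by ring
    _ ≤ C * |R| ^ r + D * |R| ^ q := by
        gcongr
        · exact hb p h0 hp
        · exact hb' p h0 hp

theorem MultBound.mul (hm : MultBound m) (hn : MultBound n) : MultBound fun p => m p * n p := by
  refine ⟨hm.1.mul hn.1, fun R => ?_⟩
  obtain ⟨C, q, hC, hb⟩ := hm.2 R
  obtain ⟨D, r, hD, hb'⟩ := hn.2 R
  refine ⟨C * D, q + r, by positivity, fun p h0 hp => ?_⟩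
  calc |m p * n p| * ‖p‖ ^ (q + r) = (|m p| * ‖p‖ ^ q) * (|n p| * ‖p‖ ^ r) := by
        rw [abs_mul]; ring
    _ ≤ C * D := mul_le_mul (hb p h0 hp) (hb' p h0 hp) (by positivity) hC

theorem MultBound.of_continuous (hm : Continuous m) : MultBound m := by
  refine ⟨hm.continuousOn, fun R => ?_⟩
  obtain ⟨C, hC⟩ := (isCompact_closedBall (0 : ℝ × ℝ) R).exists_bound_of_continuousOn
    hm.continuousOn
  refine ⟨|C|, 0, abs_nonneg C, fun p _ hp => ?_⟩
  simpa using (hC p (by simpa using hp)).trans (le_abs_self C)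

theorem FlatBound.abs_mul_le (hm : MultBound m) (hf : FlatBound f) (N : ℕ) (R : ℝ) :
    ∃ C, 0 ≤ C ∧ ∀ p, ‖p‖ ≤ R → |m p * f p| ≤ C * ‖p‖ ^ N := by
  obtain ⟨C, q, hC, hb⟩ := hm.2 R
  obtain ⟨D, hD, hb'⟩ := hf.2 (N + q) R
  refine ⟨C * D, by positivity, fun p hp => ?_⟩
  rcases eq_or_ne p 0 with rfl | h0
  · rw [hf.apply_zero, mul_zero, abs_zero]
    positivity
  · calc |m p * f p| ≤ |m p| * (D * ‖p‖ ^ (N + q)) := by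
          rw [abs_mul]; gcongr; exact hb' p hp
      _ = (|m p| * ‖p‖ ^ q) * (D * ‖p‖ ^ N) := by ring
      _ ≤ C * (D * ‖p‖ ^ N) := by gcongr; exact hb p h0 hp
      _ = _ := by ring

theorem hasFDerivAt_zero_of_abs_le {C : ℝ} (h : ∀ p, ‖p‖ ≤ 1 → |f p| ≤ C * ‖p‖ ^ 2) :
    HasFDerivAt f (0 : ℝ × ℝ →L[ℝ] ℝ) 0 := by
  have hO : f =O[nhds 0] fun p => ‖p - 0‖ ^ 2 := by
    refine Asymptotics.IsBigO.of_bound C ?_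
    filter_upwards [Metric.closedBall_mem_nhds (0 : ℝ × ℝ) one_pos] with p hp
    simpa using h p (by simpa using hp)
  exact hO.hasFDerivAt one_lt_two

theorem FlatBound.mult_mul (hm : MultBound m) (hf : FlatBound f) :
    FlatBound fun p => m p * f p := by
  refine ⟨continuous_iff_continuousAt.2 fun p => ?_, hf.abs_mul_le hm⟩
  rcases eq_or_ne p 0 with rfl | h0
  · obtain ⟨C, -, hC⟩ := hf.abs_mul_le hm 2 1
    exact (hasFDerivAt_zero_of_abs_le hC).continuousAt
  · exact (hm.1.continuousAt (isOpen_compl_singleton.mem_nhds h0)).mul hf.1.continuousAt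

theorem IsMult.multBound (hm : IsMult k m) : MultBound m := by
  cases k with
  | zero => exact hm
  | succ k => exact hm.1

theorem IsMult.of_succ : ∀ {k : ℕ} {m : ℝ × ℝ → ℝ}, IsMult (k + 1) m → IsMult k m
  | 0, _, hm => hm.1
  | _ + 1, _, ⟨h0, m₁, m₂, h1, h2, hd⟩ => ⟨h0, m₁, m₂, h1.of_succ, h2.of_succ, hd⟩

theorem IsMult.const (c : ℝ) : ∀ k : ℕ, IsMult k fun _ => c := by
  intro k
  induction k generalizing c with
  | zero => exact MultBound.of_continuous continuous_const
  | succ k ih =>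
    refine ⟨MultBound.of_continuous continuous_const, _, _, ih 0, ih 0, fun p _ => ?_⟩
    rw [gradCLM_zero]
    exact hasFDerivAt_const c p

theorem IsMult.fst : ∀ k : ℕ, IsMult k fun p => p.1
  | 0 => MultBound.of_continuous continuous_fst
  | k + 1 => ⟨MultBound.of_continuous continuous_fst, _, _, IsMult.const 1 k, IsMult.const 0 k,
      fun _ _ => hasFDerivAt_fst.congr_fderiv (by ext <;> simp)⟩

theorem IsMult.snd : ∀ k : ℕ, IsMult k fun p => p.2
  | 0 => MultBound.of_continuous continuous_snd
  | k + 1 => ⟨MultBound.of_continuous continuous_snd, _, _, IsMult.const 0 k, IsMult.const 1 k,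
      fun _ _ => hasFDerivAt_snd.congr_fderiv (by ext <;> simp)⟩

theorem IsMult.add : ∀ {k : ℕ} {m n : ℝ × ℝ → ℝ}, IsMult k m → IsMult k n →
    IsMult k fun p => m p + n p
  | 0, _, _, hm, hn => MultBound.add hm hn
  | _ + 1, _, _, ⟨h0, _, _, h1, h2, hd⟩, ⟨h0', _, _, h1', h2', hd'⟩ =>
    ⟨h0.add h0', _, _, h1.add h1', h2.add h2', fun p hp =>
      ((hd p hp).add (hd' p hp)).congr_fderiv (by ext <;> simp)⟩

theorem IsMult.mul : ∀ {k : ℕ} {m n : ℝ × ℝ → ℝ}, IsMult k m → IsMult k n →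
    IsMult k fun p => m p * n p
  | 0, _, _, hm, hn => MultBound.mul hm hn
  | k + 1, m, n, ⟨h0, m₁, m₂, h1, h2, hd⟩, ⟨h0', n₁, n₂, h1', h2', hd'⟩ => by
    have hm : IsMult k m := IsMult.of_succ ⟨h0, m₁, m₂, h1, h2, hd⟩
    have hn : IsMult k n := IsMult.of_succ ⟨h0', n₁, n₂, h1', h2', hd'⟩
    exact ⟨h0.mul h0', _, _, (hm.mul h1').add (hn.mul h1), (hm.mul h2').add (hn.mul h2),
      fun p hp => ((hd p hp).mul (hd' p hp)).congr_fderiv (by ext <;> simp)⟩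

theorem IsMult.comp {h : ℝ × ℝ → ℝ}
    (hbdd : ∀ R : ℝ, ∃ M, ∀ p, p ≠ 0 → ‖p‖ ≤ R → |h p| ≤ M) :
    ∀ {k : ℕ} {A : ℝ → ℝ}, ContDiff ℝ (⊤ : ℕ∞) A → IsMult k h → IsMult k fun p => A (h p) := by
  have h0 : ∀ {A : ℝ → ℝ}, Continuous A → MultBound h → MultBound fun p => A (h p) := by
    intro A hA hh
    refine ⟨hA.comp_continuousOn hh.1, fun R => ?_⟩
    obtain ⟨M, hM⟩ := hbdd R
    obtain ⟨C, hC⟩ := (isCompact_Icc (a := -M) (b := M)).exists_bound_of_continuousOn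
      hA.continuousOn
    refine ⟨|C|, 0, abs_nonneg C, fun p h0 hp => ?_⟩
    simpa using (hC _ (abs_le.1 (hM p h0 hp))).trans (le_abs_self C)
  intro k
  induction k with
  | zero => exact fun hA hh => h0 hA.continuous hh
  | succ k ih =>
    intro A hA hh
    have hA' : ContDiff ℝ (⊤ : ℕ∞) (deriv A) := by
      simpa using (contDiff_infty_iff_deriv.1 hA).2
    obtain ⟨h₁, h₂, hm₁, hm₂, hd⟩ := hh.2
    have hD := ih hA' hh.of_succ
    exact ⟨h0 hA.continuous hh.1, _, _, hD.mul hm₁, hD.mul hm₂, fun p hp =>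
      ((hA.differentiable (by simp)).differentiableAt.hasDerivAt.hasFDerivAt.comp p
        (hd p hp)).congr_fderiv (by ext <;> simp [mul_comm])⟩

theorem IsFlat.mult_mul : ∀ {k : ℕ} {m f : ℝ × ℝ → ℝ}, IsMult k m → IsFlat k f →
    IsFlat k fun p => m p * f p
  | 0, _, _, hm, hf => FlatBound.mult_mul hm hf
  | k + 1, m, f, ⟨h0, m₁, m₂, h1, h2, hd⟩, ⟨h0', f₁, f₂, h1', h2', hd'⟩ => by
    have hm : IsMult k m := IsMult.of_succ ⟨h0, m₁, m₂, h1, h2, hd⟩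
    have hf : IsFlat k f := IsFlat.of_succ ⟨h0', f₁, f₂, h1', h2', hd'⟩
    refine ⟨h0'.mult_mul h0, _, _, (h1'.mult_mul hm).add (hf.mult_mul h1),
      (h2'.mult_mul hm).add (hf.mult_mul h2), fun p => ?_⟩
    rcases eq_or_ne p 0 with rfl | hp
    · obtain ⟨C, -, hC⟩ := h0'.abs_mul_le h0 2 1
      refine (hasFDerivAt_zero_of_abs_le hC).congr_fderiv ?_
      ext <;> simp [h0'.apply_zero, h1'.flatBound.apply_zero, h2'.flatBound.apply_zero]
    · exact ((hd p hp).mul (hd' p)).congr_fderiv (by ext <;> simp <;> ring)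

end Mult

theorem sq_norm_le_sq_add_sq (p : ℝ × ℝ) : ‖p‖ ^ 2 ≤ p.1 ^ 2 + p.2 ^ 2 := by
  rw [Prod.norm_def, Real.norm_eq_abs, Real.norm_eq_abs]
  rcases max_choice |p.1| |p.2| with h | h <;> rw [h, sq_abs] <;>
    nlinarith [sq_nonneg p.1, sq_nonneg p.2]

theorem inv_sq_add_sq_mul_sq_norm_le (p : ℝ × ℝ) : (p.1 ^ 2 + p.2 ^ 2)⁻¹ * ‖p‖ ^ 2 ≤ 1 := by
  rw [inv_mul_eq_div]
  exact div_le_one_of_le₀ (sq_norm_le_sq_add_sq p) (by positivity)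

theorem IsMult.inv_sq_add_sq : ∀ k : ℕ, IsMult k fun p => (p.1 ^ 2 + p.2 ^ 2)⁻¹ := by
  have hne : ∀ p : ℝ × ℝ, p ≠ 0 → p.1 ^ 2 + p.2 ^ 2 ≠ 0 := fun p hp =>
    ((pow_pos (norm_pos_iff.2 hp) 2).trans_le (sq_norm_le_sq_add_sq p)).ne'
  have h0 : MultBound fun p : ℝ × ℝ => (p.1 ^ 2 + p.2 ^ 2)⁻¹ := by
    refine ⟨ContinuousOn.inv₀ (by fun_prop) fun p hp => hne p hp, fun R =>
      ⟨1, 2, zero_le_one, fun p _ _ => ?_⟩⟩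
    rw [abs_of_nonneg (by positivity)]
    exact inv_sq_add_sq_mul_sq_norm_le p
  intro k
  induction k with
  | zero => exact h0
  | succ k ih =>
    refine ⟨h0, _, _, (((IsMult.const (-2) k).mul (IsMult.fst k)).mul ih).mul ih,
      (((IsMult.const (-2) k).mul (IsMult.snd k)).mul ih).mul ih, fun p hp => ?_⟩
    have hd : HasFDerivAt (fun p : ℝ × ℝ => p.1 ^ 2 + p.2 ^ 2) (gradCLM (2 * p.1) (2 * p.2)) p :=
      ((hasFDerivAt_fst.pow 2).add (hasFDerivAt_snd.pow 2)).congr_fderiv (by ext <;> simp)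
    refine ((hasDerivAt_inv (hne p hp)).hasFDerivAt.comp p hd).congr_fderiv ?_
    rw [sq (p.1 ^ 2 + p.2 ^ 2), mul_inv]
    ext <;> simp <;> ring

/-- A bounded smooth function of the harmonic mean `2 a b / (a + b)`, divided by `(a + b) ^ 2`,
agrees on the positive quadrant with an admissible multiplier of inverse square size. -/
theorem exists_isMult_potential {A : ℝ → ℝ} (hA : ContDiff ℝ (⊤ : ℕ∞) A) {K : ℝ}
    (hK : ∀ x, |A x| ≤ K) :
    ∃ V : ℝ × ℝ → ℝ, (∀ k, IsMult k V) ∧ (∃ K', ∀ p, |V p| * ‖p‖ ^ 2 ≤ K') ∧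
      ∀ a b : ℝ, 0 < a → 0 < b → V (a, b) = A (2 * a * b / (a + b)) / (a + b) ^ 2 := by
  obtain ⟨ψ, hψ, hψeq, M, hM⟩ := ContDiffOn.exists_contDiff_bounded_eqOn_Icc
    (f := fun t : ℝ => (1 + 2 * t)⁻¹) (r := 1 / 2) (R := 1) (by norm_num) (by norm_num)
    (ContDiffOn.inv (by fun_prop) fun t ht => by have := ht.1; positivity)
  obtain ⟨σ, hσ⟩ : ∃ σ : ℝ × ℝ → ℝ, σ = fun p => (p.1 ^ 2 + p.2 ^ 2)⁻¹ := ⟨_, rfl⟩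
  have hσm : ∀ k, IsMult k σ := fun k => hσ ▸ IsMult.inv_sq_add_sq k
  obtain ⟨t, ht⟩ : ∃ t : ℝ × ℝ → ℝ, t = fun p => p.1 * p.2 * σ p := ⟨_, rfl⟩
  have htm : ∀ k, IsMult k t := fun k => ht ▸ ((IsMult.fst k).mul (IsMult.snd k)).mul (hσm k)
  have htb : ∀ p, |t p| ≤ 1 := by
    intro p
    rw [ht, hσ]
    simp only
    rw [← div_eq_mul_inv, abs_div, abs_of_nonneg (by positivity : 0 ≤ p.1 ^ 2 + p.2 ^ 2)]
    refine div_le_one_of_le₀ (abs_le.2 ⟨?_, ?_⟩) (by positivity)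
    · nlinarith [sq_nonneg (p.1 + p.2), sq_nonneg p.1, sq_nonneg p.2]
    · nlinarith [sq_nonneg (p.1 - p.2), sq_nonneg p.1, sq_nonneg p.2]
  have hψm : ∀ k, IsMult k fun p => ψ (t p) := fun k =>
    IsMult.comp (fun _ => ⟨1, fun p _ _ => htb p⟩) hψ (htm k)
  have hhm : ∀ k, IsMult k fun p => 2 * t p * (p.1 + p.2) * ψ (t p) := fun k =>
    (((IsMult.const 2 k).mul (htm k)).mul ((IsMult.fst k).add (IsMult.snd k))).mul (hψm k)
  have hhb : ∀ R : ℝ, ∃ M, ∀ p : ℝ × ℝ, p ≠ 0 → ‖p‖ ≤ R →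
      |2 * t p * (p.1 + p.2) * ψ (t p)| ≤ M := by
    intro R
    refine ⟨2 * 1 * (R + R) * M, fun p _ hp => ?_⟩
    have h1 : |p.1| ≤ R := (norm_fst_le p).trans hp
    have h2 : |p.2| ≤ R := (norm_snd_le p).trans hp
    have hR : 0 ≤ R := (norm_nonneg p).trans hp
    rw [abs_mul, abs_mul, abs_mul, abs_two]
    gcongr
    · exact htb p
    · exact (abs_add_le _ _).trans (add_le_add h1 h2)
    · exact hM _
  refine ⟨fun p => A (2 * t p * (p.1 + p.2) * ψ (t p)) * (σ p * ψ (t p)),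
    fun k => (IsMult.comp hhb hA (hhm k)).mul ((hσm k).mul (hψm k)), ⟨K * M, fun p => ?_⟩, ?_⟩
  · have hK0 : 0 ≤ K := (abs_nonneg _).trans (hK 0)
    have hM0 : 0 ≤ M := (abs_nonneg _).trans (hM 0)
    have h1 : |σ p| * ‖p‖ ^ 2 ≤ 1 := by
      rw [hσ, abs_of_nonneg (by positivity)]
      exact inv_sq_add_sq_mul_sq_norm_le p
    rw [abs_mul, abs_mul]
    calc |A (2 * t p * (p.1 + p.2) * ψ (t p))| * (|σ p| * |ψ (t p)|) * ‖p‖ ^ 2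
        = |A (2 * t p * (p.1 + p.2) * ψ (t p))| * |ψ (t p)| * (|σ p| * ‖p‖ ^ 2) := by ring
      _ ≤ K * M * 1 := by
          gcongr
          · exact hK _
          · exact hM _
      _ = K * M := mul_one _
  · intro a b ha hb
    have htv : t (a, b) = a * b / (a ^ 2 + b ^ 2) := by rw [ht, hσ]; rfl
    have hψv : ψ (t (a, b)) = (1 + 2 * (a * b / (a ^ 2 + b ^ 2)))⁻¹ := by
      rw [htv]
      refine hψeq ⟨by positivity, ?_⟩
      rw [div_le_div_iff₀ (by positivity) (by norm_num)]
      nlinarith [sq_nonneg (a - b)]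
    have hψv' : ψ (t (a, b)) = (a ^ 2 + b ^ 2) / (a + b) ^ 2 := by
      rw [hψv]; field_simp; ring
    simp only
    rw [hψv', htv, hσ, div_eq_mul_inv _ ((a + b) ^ 2)]
    congr 1
    · congr 1
      field_simp
    · simp only
      field_simp

section Solution

variable {V : ℝ × ℝ → ℝ} {K : ℝ}

theorem exists_sixteen_mul_le (K : ℝ) (N : ℕ) : ∃ m : ℕ, N ≤ m ∧ 16 * K ≤ 2 * m + 1 := by
  obtain ⟨n, hn⟩ := exists_nat_ge (8 * K)
  refine ⟨max N n, le_max_left _ _, ?_⟩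
  have : (n : ℝ) ≤ (max N n : ℕ) := by exact_mod_cast le_max_right N n
  linarith

/-- For large `m`, the operator `z ↦ triInt (V * z)` is a contraction with factor `1 / 2` for the
weighted supremum norm with weight `‖·‖ ^ (2 * m + 2)`. -/
theorem abs_triInt_mul_le (hK : ∀ p, |V p| * ‖p‖ ^ 2 ≤ K) {m : ℕ} (hm : 16 * K ≤ 2 * m + 1)
    {z : ℝ × ℝ → ℝ} {C : ℝ} (hC : 0 ≤ C) {p : ℝ × ℝ}
    (hz : ∀ a ∈ uIcc p.1 p.2, ∀ b ∈ uIcc p.1 p.2, |z (a, b)| ≤ C * ‖(a, b)‖ ^ (2 * m + 2)) :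
    |triInt (fun q => V q * z q) p| ≤ C / 2 * ‖p‖ ^ (2 * m + 2) := by
  have hK0 : 0 ≤ K := by simpa using hK 0
  refine (abs_triInt_le (mul_nonneg hK0 hC) m fun a ha b hb => ?_).trans ?_
  · calc |V (a, b) * z (a, b)| ≤ |V (a, b)| * (C * ‖(a, b)‖ ^ (2 * m + 2)) := by
          rw [abs_mul]; gcongr; exact hz a ha b hb
      _ = |V (a, b)| * ‖(a, b)‖ ^ 2 * (C * ‖(a, b)‖ ^ (2 * m)) := by ring
      _ ≤ K * (C * ‖(a, b)‖ ^ (2 * m)) := by gcongr; exact hK _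
      _ = _ := by ring
  · refine mul_le_mul_of_nonneg_right ?_ (by positivity)
    rw [div_le_div_iff₀ (by positivity) two_pos]
    nlinarith

/-- The Picard iterates of `u = u₀ - triInt (V * u)`. -/
noncomputable def picard (V u₀ : ℝ × ℝ → ℝ) : ℕ → ℝ × ℝ → ℝ
  | 0 => fun _ => 0
  | n + 1 => fun p => u₀ p - triInt (fun q => V q * picard V u₀ n q) p

theorem isFlat_zero_picard (hV : MultBound V) {u₀ : ℝ × ℝ → ℝ} (h₀ : IsFlat 0 u₀) :
    ∀ n, IsFlat 0 (picard V u₀ n)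
  | 0 => IsFlat.zero 0
  | n + 1 => h₀.sub (IsFlat.mult_mul (k := 0) hV (isFlat_zero_picard hV h₀ n)).triInt.of_succ

theorem triInt_mul_sub (hV : MultBound V) {f g : ℝ × ℝ → ℝ} (hf : FlatBound f) (hg : FlatBound g)
    (p : ℝ × ℝ) : triInt (fun q => V q * (f q - g q)) p =
      triInt (fun q => V q * f q) p - triInt (fun q => V q * g q) p := by
  rw [← triInt_sub (hf.mult_mul hV).1 (hg.mult_mul hV).1]
  simp only [mul_sub]

theorem abs_picard_sub_le (hV : MultBound V) (hK : ∀ p, |V p| * ‖p‖ ^ 2 ≤ K) {m : ℕ}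
    (hm : 16 * K ≤ 2 * m + 1) {u₀ : ℝ × ℝ → ℝ} (h₀ : IsFlat 0 u₀) {C R : ℝ} (hC : 0 ≤ C)
    (hCu : ∀ p, ‖p‖ ≤ R → |u₀ p| ≤ C * ‖p‖ ^ (2 * m + 2)) (n : ℕ) :
    ∀ p, ‖p‖ ≤ R → |picard V u₀ (n + 1) p - picard V u₀ n p| ≤ C / 2 ^ n * ‖p‖ ^ (2 * m + 2) := by
  induction n with
  | zero =>
    intro p hp
    simpa [picard, triInt] using hCu p hp
  | succ n ih =>
    intro p hp
    have h := abs_triInt_mul_le (V := V) hK hm (C := C / 2 ^ n) (p := p)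
      (z := fun q => picard V u₀ (n + 1) q - picard V u₀ n q) (by positivity) fun a ha b hb =>
        ih _ ((norm_le_norm_of_mem_uIcc ha hb).trans hp)
    rw [triInt_mul_sub hV (isFlat_zero_picard hV h₀ _) (isFlat_zero_picard hV h₀ _)] at h
    rw [pow_succ, ← div_div, picard, picard, sub_sub_sub_cancel_left, abs_sub_comm]
    exact h

theorem exists_flat_solution (hV : ∀ k, IsMult k V) (hK : ∀ p, |V p| * ‖p‖ ^ 2 ≤ K)
    {u₀ : ℝ × ℝ → ℝ} (h₀ : ∀ k, IsFlat k u₀) :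
    ∃ u, (∀ k, IsFlat k u) ∧ ∀ p, u p = u₀ p - triInt (fun q => V q * u q) p := by
  have hV0 : MultBound V := hV 0
  have hest : ∀ (N : ℕ) (R : ℝ), ∃ (m : ℕ) (C : ℝ), N ≤ m ∧ 16 * K ≤ 2 * m + 1 ∧ 0 ≤ C ∧
      ∀ p, ‖p‖ ≤ R → ∀ n, dist (picard V u₀ n p) (picard V u₀ (n + 1) p) ≤
        2 * C * ‖p‖ ^ (2 * m + 2) / 2 / 2 ^ n := by
    intro N R
    obtain ⟨m, hNm, hm⟩ := exists_sixteen_mul_le K N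
    obtain ⟨C, hC, hb⟩ := (h₀ 0).flatBound.2 (2 * m + 2) R
    refine ⟨m, C, hNm, hm, hC, fun p hp n => ?_⟩
    rw [dist_comm, Real.dist_eq]
    refine (abs_picard_sub_le hV0 hK hm (h₀ 0) hC hb n p hp).trans_eq ?_
    ring
  have hlim : ∀ p, ∃ l, Filter.Tendsto (fun n => picard V u₀ n p) Filter.atTop (nhds l) := by
    intro p
    obtain ⟨m, C, -, -, -, h⟩ := hest 0 ‖p‖
    exact cauchySeq_tendsto_of_complete (cauchySeq_of_le_geometric_two (h p le_rfl))
  choose u hu using hlim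
  have happrox : ∀ (N : ℕ) (R : ℝ), ∃ (m : ℕ) (C : ℝ), N ≤ m ∧ 16 * K ≤ 2 * m + 1 ∧ 0 ≤ C ∧
      ∀ p, ‖p‖ ≤ R → ∀ n, |u p - picard V u₀ n p| ≤ C / 2 ^ n * ‖p‖ ^ (2 * m + 2) := by
    intro N R
    obtain ⟨m, C, hNm, hm, hC, h⟩ := hest N R
    refine ⟨m, 2 * C, hNm, hm, by positivity, fun p hp n => ?_⟩
    rw [← Real.dist_eq, dist_comm]
    refine (dist_le_of_le_geometric_two_of_tendsto (h p hp) (hu p) n).trans_eq ?_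
    ring
  have hcont : Continuous u := by
    refine continuous_iff_continuousAt.2 fun p => ?_
    obtain ⟨m, C, -, -, hC, h⟩ := happrox 0 (‖p‖ + 1)
    have hunif : TendstoUniformlyOn (picard V u₀) u Filter.atTop
        (Metric.closedBall 0 (‖p‖ + 1)) := by
      rw [Metric.tendstoUniformlyOn_iff]
      intro ε hε
      have ht : Filter.Tendsto (fun n : ℕ => C * (‖p‖ + 1) ^ (2 * m + 2) * (1 / 2 : ℝ) ^ n)
          Filter.atTop (nhds 0) := by
        simpa using (tendsto_pow_atTop_nhds_zero_of_lt_one (by norm_num : (0 : ℝ) ≤ 1 / 2)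
          (by norm_num)).const_mul (C * (‖p‖ + 1) ^ (2 * m + 2))
      filter_upwards [ht.eventually_lt_const hε] with n hn q hq
      have hq' : ‖q‖ ≤ ‖p‖ + 1 := by simpa using hq
      rw [Real.dist_eq]
      refine ((h q hq' n).trans ?_).trans_lt hn
      calc C / 2 ^ n * ‖q‖ ^ (2 * m + 2) ≤ C / 2 ^ n * (‖p‖ + 1) ^ (2 * m + 2) := by gcongr
        _ = _ := by rw [div_pow, one_pow]; ring
    refine (hunif.continuousOn (Filter.Frequently.of_forall fun n =>
      (isFlat_zero_picard hV0 (h₀ 0) n).flatBound.1.continuousOn)).continuousAt ?_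
    refine Filter.mem_of_superset (Metric.closedBall_mem_nhds p one_pos) fun q hq => ?_
    rw [mem_closedBall_zero_iff]
    rw [mem_closedBall_iff_norm] at hq
    linarith [norm_le_norm_add_norm_sub' q p]
  have hflat : FlatBound u := by
    refine FlatBound.of_bound hcont fun N R _ => ?_
    obtain ⟨m, C, hN, -, hC, h⟩ := happrox N R
    refine ⟨C, 2 * m + 2, hC, by omega, fun p hp => ?_⟩
    simpa [picard] using h p hp 0
  have heq : ∀ p, u p = u₀ p - triInt (fun q => V q * u q) p := by
    intro p
    obtain ⟨m, C, -, hm, hC, h⟩ := happrox 0 ‖p‖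
    refine tendsto_nhds_unique ((Filter.tendsto_add_atTop_iff_nat 1).2 (hu p)) ?_
    rw [tendsto_iff_dist_tendsto_zero]
    have ht : Filter.Tendsto (fun n : ℕ => C / 2 * ‖p‖ ^ (2 * m + 2) * (1 / 2 : ℝ) ^ n)
        Filter.atTop (nhds 0) := by
      simpa using (tendsto_pow_atTop_nhds_zero_of_lt_one (by norm_num : (0 : ℝ) ≤ 1 / 2)
        (by norm_num)).const_mul (C / 2 * ‖p‖ ^ (2 * m + 2))
    refine squeeze_zero (fun _ => dist_nonneg) (fun n => ?_) ht
    have h' := abs_triInt_mul_le (V := V) hK hm (C := C / 2 ^ n) (p := p)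
      (z := fun q => u q - picard V u₀ n q) (by positivity) fun a ha b hb =>
        h _ (norm_le_norm_of_mem_uIcc ha hb) n
    rw [triInt_mul_sub hV0 hflat (isFlat_zero_picard hV0 (h₀ 0) _)] at h'
    rw [Real.dist_eq, picard, sub_sub_sub_cancel_left]
    refine h'.trans_eq ?_
    rw [div_pow, one_pow]
    ring
  refine ⟨u, fun k => ?_, heq⟩
  induction k with
  | zero => exact hflat
  | succ k ih =>
    rw [funext heq]
    exact (h₀ (k + 1)).sub (ih.mult_mul (hV k)).triInt

/-- A function that is continuous on an open square and satisfies the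
homogeneous integral equation there vanishes. -/
theorem eq_zero_of_eq_neg_triInt (hK : ∀ p, |V p| * ‖p‖ ^ 2 ≤ K) {T : ℝ} {z : ℝ × ℝ → ℝ}
    (hz : ContinuousOn z (Ioo 0 T ×ˢ Ioo 0 T))
    (heq : ∀ p ∈ Ioo 0 T ×ˢ Ioo 0 T, z p = -triInt (fun q => V q * z q) p) {p : ℝ × ℝ}
    (hp : p ∈ Ioo 0 T ×ˢ Ioo 0 T) : z p = 0 := by
  obtain ⟨m, -, hm⟩ := exists_sixteen_mul_le K 0
  have hsub : uIcc p.1 p.2 ⊆ Ioo 0 T := (ordConnected_Ioo).uIcc_subset hp.1 hp.2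
  have hS : uIcc p.1 p.2 ×ˢ uIcc p.1 p.2 ⊆ Ioo 0 T ×ˢ Ioo 0 T := prod_mono hsub hsub
  have hpos : ∀ q ∈ Ioo 0 T ×ˢ Ioo 0 T, 0 < ‖q‖ := fun q hq =>
    (lt_of_lt_of_le hq.1.1 (le_abs_self _)).trans_le (norm_fst_le q)
  obtain ⟨q, hq, hmax⟩ := (isCompact_uIcc.prod isCompact_uIcc).exists_isMaxOn
    (⟨p, left_mem_uIcc, right_mem_uIcc⟩ : (uIcc p.1 p.2 ×ˢ uIcc p.1 p.2).Nonempty)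
    (f := fun q => |z q| / ‖q‖ ^ (2 * m + 2))
    ((hz.mono hS).abs.div (by fun_prop) fun q hq => (pow_pos (hpos q (hS hq)) _).ne')
  obtain ⟨C, hC⟩ : ∃ C, C = |z q| / ‖q‖ ^ (2 * m + 2) := ⟨_, rfl⟩
  have hC0 : 0 ≤ C := hC ▸ by positivity
  have hbd : ∀ r ∈ uIcc p.1 p.2 ×ˢ uIcc p.1 p.2, |z r| ≤ C * ‖r‖ ^ (2 * m + 2) := by
    intro r hr
    rw [← div_le_iff₀ (pow_pos (hpos r (hS hr)) _), hC]
    exact hmax hr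
  have hle : |z q| ≤ C / 2 * ‖q‖ ^ (2 * m + 2) := by
    rw [heq q (hS hq), abs_neg]
    refine abs_triInt_mul_le hK hm hC0 fun a ha b hb => hbd _ ?_
    have hsub' := uIcc_subset_uIcc hq.1 hq.2
    exact ⟨hsub' ha, hsub' hb⟩
  rw [← div_le_iff₀ (pow_pos (hpos q (hS hq)) _), ← hC] at hle
  have hCz : C = 0 := by linarith
  have := hbd p ⟨left_mem_uIcc, right_mem_uIcc⟩
  rw [hCz, zero_mul] at this
  exact abs_nonpos_iff.1 this

end Solution

section Square

variable {w V : ℝ × ℝ → ℝ} {T : ℝ}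

theorem hasDerivAt_snd_of_contDiffOn (hw : ContDiffOn ℝ (⊤ : ℕ∞) w (Ioo 0 T ×ˢ Ioo 0 T))
    {p : ℝ × ℝ} (hp : p ∈ Ioo 0 T ×ˢ Ioo 0 T) :
    HasDerivAt (fun b => w (p.1, b)) (fderiv ℝ w p (0, 1)) p.2 := by
  have hl : HasDerivAt (fun b : ℝ => (p.1, b)) ((0 : ℝ), (1 : ℝ)) p.2 :=
    (hasDerivAt_const p.2 p.1).prodMk (hasDerivAt_id p.2)
  have hd := (hw.contDiffAt ((isOpen_Ioo.prod isOpen_Ioo).mem_nhds hp)).differentiableAt (by simp)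
  exact hd.hasFDerivAt.comp_hasDerivAt p.2 hl

theorem hasDerivAt_fst_of_contDiffOn (hw : ContDiffOn ℝ (⊤ : ℕ∞) w (Ioo 0 T ×ˢ Ioo 0 T))
    {p : ℝ × ℝ} (hp : p ∈ Ioo 0 T ×ˢ Ioo 0 T) :
    HasDerivAt (fun a => w (a, p.2)) (fderiv ℝ w p (1, 0)) p.1 := by
  have hl : HasDerivAt (fun a : ℝ => (a, p.2)) ((1 : ℝ), (0 : ℝ)) p.1 :=
    (hasDerivAt_id p.1).prodMk (hasDerivAt_const p.1 p.2)
  have hd := (hw.contDiffAt ((isOpen_Ioo.prod isOpen_Ioo).mem_nhds hp)).differentiableAt (by simp)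
  exact hd.hasFDerivAt.comp_hasDerivAt p.1 hl

theorem contDiffOn_fderiv_snd (hw : ContDiffOn ℝ (⊤ : ℕ∞) w (Ioo 0 T ×ˢ Ioo 0 T)) :
    ContDiffOn ℝ (⊤ : ℕ∞) (fun p => fderiv ℝ w p (0, 1)) (Ioo 0 T ×ˢ Ioo 0 T) :=
  (hw.fderiv_of_isOpen (isOpen_Ioo.prod isOpen_Ioo) (by simp)).clm_apply contDiffOn_const

theorem fderiv_snd_diagonal (hw : ContDiffOn ℝ (⊤ : ℕ∞) w (Ioo 0 T ×ˢ Ioo 0 T)) {Q : ℝ → ℝ}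
    (heq : ∀ x ∈ Ioo 0 T, Q x = w (x, x)) {x : ℝ}
    (hx : x ∈ Ioo 0 T) :
    fderiv ℝ w (x, x) (0, 1) = deriv Q x - fderiv ℝ w (x, x) (1, 0) := by
  have hS : ((x, x) : ℝ × ℝ) ∈ Ioo 0 T ×ˢ Ioo 0 T := ⟨hx, hx⟩
  have hl : HasDerivAt (fun b : ℝ => (b, b)) ((1 : ℝ), (1 : ℝ)) x :=
    (hasDerivAt_id x).prodMk (hasDerivAt_id x)
  have hd := (hw.contDiffAt ((isOpen_Ioo.prod isOpen_Ioo).mem_nhds hS)).differentiableAt (by simp)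
  have h1 : HasDerivAt (fun b => w (b, b)) (fderiv ℝ w (x, x) (1, 1)) x :=
    HasFDerivAt.comp_hasDerivAt x hd.hasFDerivAt hl
  have h2 : HasDerivAt Q (fderiv ℝ w (x, x) (1, 1)) x :=
    h1.congr_of_eventuallyEq (Filter.eventually_of_mem (isOpen_Ioo.mem_nhds hx) heq)
  rw [h2.deriv, ← map_sub]
  simp

/-- A solution of `∂₁ ∂₂ w = V w` on an open square satisfies the integral equation determined by
its Cauchy data on the diagonal. -/
theorem eq_data_sub_triInt (hw : ContDiffOn ℝ (⊤ : ℕ∞) w (Ioo 0 T ×ˢ Ioo 0 T))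
    (hV : ContinuousOn V (Ioo 0 T ×ˢ Ioo 0 T))
    (hpde : ∀ p ∈ Ioo 0 T ×ˢ Ioo 0 T,
      HasDerivAt (fun a => fderiv ℝ w (a, p.2) (0, 1)) (V p * w p) p.1)
    {F G : ℝ → ℝ} (hG : ContDiff ℝ (⊤ : ℕ∞) G) (hw0 : ∀ x ∈ Ioo 0 T, w (x, x) = F x + G x)
    (hw1 : ∀ x ∈ Ioo 0 T, fderiv ℝ w (x, x) (0, 1) = deriv G x) {p : ℝ × ℝ}
    (hp : p ∈ Ioo 0 T ×ˢ Ioo 0 T) :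
    IntervalIntegrable (fun b => horInt (fun q => V q * w q) (p.1, b)) volume p.1 p.2 ∧
      w p = F p.1 + G p.2 - triInt (fun q => V q * w q) p := by
  have hsub : ∀ {x y : ℝ}, x ∈ Ioo 0 T → y ∈ Ioo 0 T → uIcc x y ⊆ Ioo 0 T := fun hx hy =>
    ordConnected_Ioo.uIcc_subset hx hy
  have hhor : ∀ b ∈ uIcc p.1 p.2, horInt (fun q => V q * w q) (p.1, b) =
      deriv G b - fderiv ℝ w (p.1, b) (0, 1) := by
    intro b hb
    have hb' := hsub hp.1 hp.2 hb
    rw [← hw1 b hb']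
    refine intervalIntegral.integral_eq_sub_of_hasDerivAt
      (f := fun a => fderiv ℝ w (a, b) (0, 1)) (fun a ha => ?_) ?_
    · exact hpde (a, b) ⟨hsub hp.1 hb' ha, hb'⟩
    · refine ContinuousOn.intervalIntegrable ?_
      exact (hV.mul hw.continuousOn).comp (by fun_prop) fun a ha => ⟨hsub hp.1 hb' ha, hb'⟩
  have hG' : Continuous (deriv G) := hG.continuous_deriv (by simp)
  have hi1 : IntervalIntegrable (deriv G) volume p.1 p.2 := hG'.intervalIntegrable _ _
  have hi2 : IntervalIntegrable (fun b => fderiv ℝ w (p.1, b) (0, 1)) volume p.1 p.2 := by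
    refine ContinuousOn.intervalIntegrable ?_
    exact (contDiffOn_fderiv_snd hw).continuousOn.comp
      (by fun_prop : Continuous fun b : ℝ => (p.1, b)).continuousOn
      fun b hb => ⟨hp.1, hsub hp.1 hp.2 hb⟩
  have htri : triInt (fun q => V q * w q) p =
      (∫ b in p.1..p.2, deriv G b) - ∫ b in p.1..p.2, fderiv ℝ w (p.1, b) (0, 1) := by
    rw [← intervalIntegral.integral_sub hi1 hi2]
    exact intervalIntegral.integral_congr hhor
  refine ⟨(hi1.sub hi2).congr fun b hb => (hhor b (uIoc_subset_uIcc hb)).symm, ?_⟩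
  have h1 : ∫ b in p.1..p.2, deriv G b = G p.2 - G p.1 :=
    intervalIntegral.integral_eq_sub_of_hasDerivAt
      (fun b _ => (hG.differentiable (by simp)).differentiableAt.hasDerivAt) hi1
  have h2 : ∫ b in p.1..p.2, fderiv ℝ w (p.1, b) (0, 1) = w (p.1, p.2) - w (p.1, p.1) :=
    intervalIntegral.integral_eq_sub_of_hasDerivAt (f := fun b => w (p.1, b))
      (fun b hb => hasDerivAt_snd_of_contDiffOn hw (p := (p.1, b)) ⟨hp.1, hsub hp.1 hp.2 hb⟩) hi2
  rw [htri, h1, h2, hw0 _ hp.1]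
  ring

/-- Solutions of the integral equation on an open square are unique. -/
theorem eq_of_integral_equation {K : ℝ} (hVm : MultBound V) (hK : ∀ p, |V p| * ‖p‖ ^ 2 ≤ K)
    {u u₀ : ℝ × ℝ → ℝ} (hu : FlatBound u)
    (hueq : ∀ p, u p = u₀ p - triInt (fun q => V q * u q) p)
    (hw : ContinuousOn w (Ioo 0 T ×ˢ Ioo 0 T))
    (hweq : ∀ p ∈ Ioo 0 T ×ˢ Ioo 0 T,
      IntervalIntegrable (fun b => horInt (fun q => V q * w q) (p.1, b)) volume p.1 p.2 ∧
        w p = u₀ p - triInt (fun q => V q * w q) p) {p : ℝ × ℝ}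
    (hp : p ∈ Ioo 0 T ×ˢ Ioo 0 T) : u p = w p := by
  have hVu : Continuous fun q => V q * u q := (hu.mult_mul hVm).1
  have hVS : ContinuousOn V (Ioo 0 T ×ˢ Ioo 0 T) := hVm.1.mono fun q hq h => by
    rw [mem_singleton_iff] at h
    subst h
    exact lt_irrefl _ hq.1.1
  have hz := eq_zero_of_eq_neg_triInt (z := fun q => w q - u q) hK (hw.sub hu.1.continuousOn)
    (fun q hq => ?_) hp
  · exact (sub_eq_zero.1 hz).symm
  · have h : triInt (fun r => V r * w r - V r * u r) q =
        triInt (fun r => V r * w r) q - triInt (fun r => V r * u r) q := by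
      refine triInt_sub_of_intervalIntegrable (f := fun r => V r * w r)
        (g := fun r => V r * u r) q (fun b hb => ?_) (fun b _ => ?_) (hweq q hq).1 ?_
      · have hb' : b ∈ Ioo 0 T := ordConnected_Ioo.uIcc_subset hq.1 hq.2 hb
        refine ContinuousOn.intervalIntegrable ?_
        exact (hVS.mul hw).comp (by fun_prop : Continuous fun a : ℝ => (a, b)).continuousOn
          fun a ha => ⟨ordConnected_Ioo.uIcc_subset hq.1 hb' ha, hb'⟩
      · exact (hVu.comp (by fun_prop : Continuous fun a : ℝ => (a, b))).intervalIntegrable _ _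
      · exact ((continuous_horInt hVu).comp
          (continuous_const.prodMk continuous_id)).intervalIntegrable _ _
    simp only [mul_sub]
    rw [h, (hweq q hq).2, hueq q]
    ring

end Square

theorem contDiff_primitive {Q : ℝ → ℝ} (hQ : ContDiff ℝ (⊤ : ℕ∞) Q) :
    ContDiff ℝ (⊤ : ℕ∞) (fun x => ∫ t in (0 : ℝ)..x, Q t) := by
  have hd : ∀ x, HasDerivAt (fun x => ∫ t in (0 : ℝ)..x, Q t) (Q x) x := fun x =>
    intervalIntegral.integral_hasDerivAt_right (hQ.continuous.intervalIntegrable _ _)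
      (hQ.continuous.stronglyMeasurableAtFilter _ _) hQ.continuous.continuousAt
  refine contDiff_infty_iff_deriv.2 ⟨fun x => (hd x).differentiableAt, ?_⟩
  rwa [funext fun x => (hd x).deriv]

theorem iteratedDeriv_primitive_zero {Q : ℝ → ℝ} (hQ : Continuous Q)
    (h0 : ∀ i, iteratedDeriv i Q 0 = 0) (i : ℕ) :
    iteratedDeriv i (fun x => ∫ t in (0 : ℝ)..x, Q t) 0 = 0 := by
  cases i with
  | zero => simp
  | succ i =>
    rw [iteratedDeriv_succ', funext fun x => hQ.deriv_integral Q 0 x]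
    exact h0 i

/-- scalar (eigenfunction-mode) smoothness-up-to-the-boundary theorem: there
exists `T₀ ∈ (0,ε/2]` such that for `0 < T ≤ T₀` every smooth solution `w` of
`(μ+ν)² ∂_μ∂_ν w − (λ φ(2μν/(μ+ν)) + B(2μν/(μ+ν))) w = 0` on `(0,T)×(0,T)` whose diagonal
traces `q₁(μ) = w(μ,μ)`, `q₂(μ) = (∂_μ w)(μ,μ)` extend to `C^∞` functions on `[0,T]` all of
whose derivatives vanish at `μ = 0`, extends to a `C^∞` function on a neighborhood of the
closed square `[0,T]×[0,T]`. -/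
theorem stmt10 (ε : ℝ) (hε : 0 < ε) (φ B : ℝ → ℝ)
    (hφ : ContDiffOn ℝ (⊤ : ℕ∞) φ (Ico 0 ε)) (hB : ContDiffOn ℝ (⊤ : ℕ∞) B (Ico 0 ε))
    (lam c₀ : ℝ) (hlam : 0 ≤ lam) (hc₀ : 0 < c₀)
    (hφpos : ∀ x ∈ Ico (0 : ℝ) ε, 0 < φ x)
    (hcoer : ∀ x ∈ Ico (0 : ℝ) ε, c₀ ≤ lam * φ x + B x) :
    ∃ T₀ : ℝ, 0 < T₀ ∧ T₀ ≤ ε / 2 ∧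
      ∀ T : ℝ, 0 < T → T ≤ T₀ →
      ∀ w : ℝ → ℝ → ℝ,
        ContDiffOn ℝ (⊤ : ℕ∞) (fun p : ℝ × ℝ => w p.1 p.2) (Ioo 0 T ×ˢ Ioo 0 T) →
        (∀ μ ∈ Ioo (0 : ℝ) T, ∀ ν ∈ Ioo (0 : ℝ) T,
          (μ + ν) ^ 2 * deriv (fun a => deriv (fun b => w a b) ν) μ
            - (lam * φ (2 * μ * ν / (μ + ν)) + B (2 * μ * ν / (μ + ν))) * w μ ν = 0) →
        (∃ Q₁ : ℝ → ℝ, ContDiff ℝ (⊤ : ℕ∞) Q₁ ∧ (∀ μ ∈ Ioo (0 : ℝ) T, Q₁ μ = w μ μ) ∧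
          ∀ i : ℕ, iteratedDeriv i Q₁ 0 = 0) →
        (∃ Q₂ : ℝ → ℝ, ContDiff ℝ (⊤ : ℕ∞) Q₂ ∧
          (∀ μ ∈ Ioo (0 : ℝ) T, Q₂ μ = deriv (fun a => w a μ) μ) ∧
          ∀ i : ℕ, iteratedDeriv i Q₂ 0 = 0) →
        ∃ U : Set (ℝ × ℝ), IsOpen U ∧ Icc (0 : ℝ) T ×ˢ Icc (0 : ℝ) T ⊆ U ∧
          ∃ W : ℝ × ℝ → ℝ, ContDiffOn ℝ (⊤ : ℕ∞) W U ∧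
            ∀ μ ∈ Ioo (0 : ℝ) T, ∀ ν ∈ Ioo (0 : ℝ) T, W (μ, ν) = w μ ν := by
  obtain ⟨A, hA, hAeq, K, hK⟩ := ContDiffOn.exists_contDiff_bounded_eqOn_Icc
    (f := fun x => lam * φ x + B x) (r := ε / 2) (R := ε) (by positivity) (by linarith)
    ((contDiffOn_const.mul hφ).add hB)
  obtain ⟨V, hVm, ⟨K', hK'⟩, hVeq⟩ := exists_isMult_potential hA hK
  refine ⟨ε / 2, by positivity, le_rfl, ?_⟩
  rintro T - hTε w hw hpde ⟨Q₁, hQ₁, hQ₁eq, hQ₁0⟩ ⟨Q₂, hQ₂, hQ₂eq, hQ₂0⟩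
  obtain ⟨F, hFdef⟩ : ∃ F : ℝ → ℝ, F = fun x => ∫ t in (0 : ℝ)..x, Q₂ t := ⟨_, rfl⟩
  have hF : ContDiff ℝ (⊤ : ℕ∞) F := hFdef ▸ contDiff_primitive hQ₂
  have hF0 : ∀ i, iteratedDeriv i F 0 = 0 :=
    hFdef ▸ iteratedDeriv_primitive_zero hQ₂.continuous hQ₂0
  have hF' : ∀ x, deriv F x = Q₂ x := fun x => by
    rw [hFdef]; exact hQ₂.continuous.deriv_integral Q₂ 0 x
  have hG : ContDiff ℝ (⊤ : ℕ∞) (fun x => Q₁ x - F x) := hQ₁.sub hF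
  have hG0 : ∀ i, iteratedDeriv i (fun x => Q₁ x - F x) 0 = 0 := by
    intro i
    rw [iteratedDeriv_fun_sub (hQ₁.of_le (by exact_mod_cast le_top)).contDiffAt
      (hF.of_le (by exact_mod_cast le_top)).contDiffAt, hQ₁0, hF0, sub_zero]
  obtain ⟨u, hu, hueq⟩ := exists_flat_solution hVm hK'
    (u₀ := fun p => F p.1 + (Q₁ p.2 - F p.2)) fun k =>
      (IsFlat.comp_fst k hF hF0).add (IsFlat.comp_fst k hG hG0).comp_swap
  refine ⟨univ, isOpen_univ, subset_univ _, u, (contDiff_iff_forall_nat_le.2 fun k _ =>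
    (hu k).contDiff).contDiffOn, fun μ hμ ν hν => ?_⟩
  obtain ⟨w', hw'⟩ : ∃ w' : ℝ × ℝ → ℝ, w' = fun p => w p.1 p.2 := ⟨_, rfl⟩
  rw [← hw'] at hw
  have hd1 : ∀ p ∈ Ioo 0 T ×ˢ Ioo 0 T, deriv (fun a => w a p.2) p.1 = fderiv ℝ w' p (1, 0) :=
    fun p hp => by simpa only [hw'] using (hasDerivAt_fst_of_contDiffOn hw hp).deriv
  have hd2 : ∀ p ∈ Ioo 0 T ×ˢ Ioo 0 T, deriv (fun b => w p.1 b) p.2 = fderiv ℝ w' p (0, 1) :=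
    fun p hp => by simpa only [hw'] using (hasDerivAt_snd_of_contDiffOn hw hp).deriv
  have hVS : ContinuousOn V (Ioo 0 T ×ˢ Ioo 0 T) := (hVm 0).multBound.1.mono fun q hq h => by
    rw [mem_singleton_iff] at h
    subst h
    exact lt_irrefl _ hq.1.1
  have hpde' : ∀ p ∈ Ioo 0 T ×ˢ Ioo 0 T,
      HasDerivAt (fun a => fderiv ℝ w' (a, p.2) (0, 1)) (V p * w' p) p.1 := by
    rintro ⟨a, b⟩ ⟨ha, hb⟩
    have hdiff : DifferentiableAt ℝ (fun a => fderiv ℝ w' (a, b) (0, 1)) a :=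
      (hasDerivAt_fst_of_contDiffOn (contDiffOn_fderiv_snd hw) (p := (a, b))
        ⟨ha, hb⟩).differentiableAt
    have hev : (fun a => deriv (fun b => w a b) b) =ᶠ[nhds a]
        fun a => fderiv ℝ w' (a, b) (0, 1) :=
      Filter.eventually_of_mem (isOpen_Ioo.mem_nhds ha) fun a' ha' => hd2 (a', b) ⟨ha', hb⟩
    have heq := hpde a ha b hb
    rw [hev.deriv_eq] at heq
    have ha0 : 0 < a := ha.1
    have hb0 : 0 < b := hb.1
    have hmem : 2 * a * b / (a + b) ∈ Icc 0 (ε / 2) := by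
      refine ⟨by positivity, ?_⟩
      rw [div_le_iff₀ (by positivity)]
      nlinarith [ha.2, hb.2]
    have hwv : w' (a, b) = w a b := by rw [hw']
    have hval : V (a, b) * w' (a, b) = deriv (fun a => fderiv ℝ w' (a, b) (0, 1)) a := by
      rw [hVeq a b ha0 hb0, hAeq hmem, hwv, div_mul_eq_mul_div,
        div_eq_iff (by positivity)]
      simp only
      linarith
    rw [hval]
    exact hdiff.hasDerivAt
  have hw0 : ∀ x ∈ Ioo 0 T, Q₁ x = w' (x, x) := fun x hx => by rw [hQ₁eq x hx, hw']
  have hw1 : ∀ x ∈ Ioo 0 T, fderiv ℝ w' (x, x) (0, 1) = deriv (fun x => Q₁ x - F x) x := by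
    intro x hx
    rw [fderiv_snd_diagonal hw hw0 hx, ← hd1 (x, x) ⟨hx, hx⟩, ← hQ₂eq x hx, ← hF' x,
      deriv_fun_sub (hQ₁.differentiable (by simp)).differentiableAt
        (hF.differentiable (by simp)).differentiableAt]
  have := eq_of_integral_equation (hVm 0) hK' (hu 0) hueq hw.continuousOn
    (fun p hp => eq_data_sub_triInt hw hVS hpde' hG
      (fun x hx => by rw [← hw0 x hx]; ring) hw1 hp) (p := (μ, ν)) ⟨hμ, hν⟩
  rw [this, hw']
end

section
/- Let U ⊂ ℝ² (coordinates (τ,r)) be an open neighborhood of the origin, let M > 0, and let F : U → ℝ be a C¹ function with |F(τ,r)| ≤ M and |r ∂_r F(τ,r)| ≤ M for all (τ,r) ∈ U. Define the operator P u = r² ∂_r² u − r² ∂_τ² u + F u. Then there exist a constant C > 0 (independent of F and M) and γ₀ > 0 (depending on M) such that for every γ ≥ γ₀ and every C^∞ function u on ℝ² whose support is a compact subset of U contained in the cone {(τ,r) : r ≥ 0 and −r ≤ τ ≤ r}, one has ‖r^{−γ−2} P u‖² ≥ C ( γ² ‖r^{−1} ∂_r (r^{−γ} u)‖² + γ² ‖r^{−1−γ}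 ∂_τ u‖² + γ⁴ ‖r^{−γ−2} u‖² ), where ‖·‖ denotes the L² norm on U with respect to Lebesgue measure dτ dr. -/
open MeasureTheory Set

/-- The closed cone `{r ≥ 0, -r ≤ τ ≤ r}` in the coordinates `(τ, r)`. -/
def coneSet : Set (ℝ × ℝ) := {p : ℝ × ℝ | 0 ≤ p.2 ∧ -p.2 ≤ p.1 ∧ p.1 ≤ p.2}

/-- Smooth compactly supported functions on the plane with support in the cone. -/
structure ConeSmooth (g : ℝ × ℝ → ℝ) : Prop where
  contDiff : ContDiff ℝ (⊤ : ℕ∞) g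
  hasCompactSupport : HasCompactSupport g
  eq_zero : ∀ p, p ∉ coneSet → g p = 0

/-- The directional derivative of `g` in the constant direction `v`. -/
noncomputable def dirDeriv (v : ℝ × ℝ) (g : ℝ × ℝ → ℝ) : ℝ × ℝ → ℝ := fun p => fderiv ℝ g p v

/-- The function `r ^ s * g`, extended by zero to `r ≤ 0`. -/
noncomputable def weighted (s : ℝ) (g : ℝ × ℝ → ℝ) : ℝ × ℝ → ℝ :=
  {p : ℝ × ℝ | 0 < p.2}.indicator fun p => p.2 ^ s * g p

lemma weighted_of_pos {s : ℝ} {g : ℝ × ℝ → ℝ} {p : ℝ × ℝ} (hp : 0 < p.2) :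
    weighted s g p = p.2 ^ s * g p :=
  indicator_of_mem (s := {p : ℝ × ℝ | 0 < p.2}) hp _

lemma weighted_of_nonpos {s : ℝ} {g : ℝ × ℝ → ℝ} {p : ℝ × ℝ} (hp : p.2 ≤ 0) :
    weighted s g p = 0 :=
  indicator_of_notMem (s := {p : ℝ × ℝ | 0 < p.2}) (not_lt.mpr hp) _

lemma weighted_of_eq_zero {s : ℝ} {g : ℝ × ℝ → ℝ} {p : ℝ × ℝ} (hp : g p = 0) :
    weighted s g p = 0 := by
  rcases lt_or_ge 0 p.2 with h | h
  · rw [weighted_of_pos h, hp, mul_zero]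
  · exact weighted_of_nonpos h

lemma weighted_nonneg {s : ℝ} {g : ℝ × ℝ → ℝ} (hg : ∀ p, 0 ≤ g p) (p : ℝ × ℝ) :
    0 ≤ weighted s g p :=
  indicator_nonneg (fun _ hq => mul_nonneg (Real.rpow_nonneg (le_of_lt hq) _) (hg _)) p

lemma isClosed_coneSet : IsClosed coneSet := by
  have h : coneSet = {p : ℝ × ℝ | 0 ≤ p.2} ∩ ({p | -p.2 ≤ p.1} ∩ {p | p.1 ≤ p.2}) := rfl
  rw [h]
  exact (isClosed_le (by fun_prop) (by fun_prop)).inter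
    ((isClosed_le (by fun_prop) (by fun_prop)).inter (isClosed_le (by fun_prop) (by fun_prop)))

lemma tsupport_dirDeriv_subset (v : ℝ × ℝ) (g : ℝ × ℝ → ℝ) :
    tsupport (dirDeriv v g) ⊆ tsupport g :=
  tsupport_fderiv_apply_subset ℝ v

lemma dirDeriv_eq_zero {v : ℝ × ℝ} {g : ℝ × ℝ → ℝ} {p : ℝ × ℝ} (hp : p ∉ tsupport g) :
    dirDeriv v g p = 0 :=
  image_eq_zero_of_notMem_tsupport fun h => hp (tsupport_dirDeriv_subset v g h)

lemma dirDeriv_comm {g : ℝ × ℝ → ℝ} (hg : ContDiff ℝ (⊤ : ℕ∞) g) (v w p : ℝ × ℝ) :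
    dirDeriv v (dirDeriv w g) p = dirDeriv w (dirDeriv v g) p := by
  have hd : DifferentiableAt ℝ (fderiv ℝ g) p :=
    (hg.fderiv_right (m := (⊤ : ℕ∞)) (by simp)).differentiable (by simp) p
  have hs : IsSymmSndFDerivAt ℝ g p := hg.contDiffAt.isSymmSndFDerivAt (by
    simpa using (WithTop.coe_le_coe.mpr le_top : ((2 : ℕ∞) : WithTop ℕ∞) ≤ ((⊤ : ℕ∞) : WithTop ℕ∞)))
  have key : ∀ a b : ℝ × ℝ, dirDeriv a (dirDeriv b g) p = fderiv ℝ (fderiv ℝ g) p a b := by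
    intro a b
    unfold dirDeriv
    rw [fderiv_clm_apply hd (differentiableAt_const b)]
    simp
  rw [key, key, hs.eq]

namespace ConeSmooth

variable {f g : ℝ × ℝ → ℝ}

lemma tsupport_subset (hg : ConeSmooth g) : tsupport g ⊆ coneSet :=
  closure_minimal (fun p hp => by_contra fun h => hp (hg.eq_zero p h)) isClosed_coneSet

lemma add (hf : ConeSmooth f) (hg : ConeSmooth g) : ConeSmooth fun p => f p + g p :=
  ⟨hf.contDiff.add hg.contDiff, hf.hasCompactSupport.add hg.hasCompactSupport,
    fun p hp => by simp [hf.eq_zero p hp, hg.eq_zero p hp]⟩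

lemma mul_left (hf : ContDiff ℝ (⊤ : ℕ∞) f) (hg : ConeSmooth g) :
    ConeSmooth fun p => f p * g p :=
  ⟨hf.mul hg.contDiff, hg.hasCompactSupport.mul_left, fun p hp => by simp [hg.eq_zero p hp]⟩

lemma const_mul (c : ℝ) (hg : ConeSmooth g) : ConeSmooth fun p => c * g p :=
  mul_left contDiff_const hg

lemma snd_mul (hg : ConeSmooth g) : ConeSmooth fun p => p.2 * g p :=
  mul_left contDiff_snd hg

lemma mul (hf : ConeSmooth f) (hg : ConeSmooth g) : ConeSmooth fun p => f p * g p :=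
  mul_left hf.contDiff hg

lemma sub (hf : ConeSmooth f) (hg : ConeSmooth g) : ConeSmooth fun p => f p - g p := by
  simpa [sub_eq_add_neg] using hf.add (hg.const_mul (-1))

lemma sq (hf : ConeSmooth f) : ConeSmooth fun p => f p ^ 2 := by
  simpa [pow_two] using hf.mul hf

lemma dirDeriv_right (hg : ConeSmooth g) (v : ℝ × ℝ) : ConeSmooth (dirDeriv v g) :=
  ⟨(hg.contDiff.fderiv_right (m := (⊤ : ℕ∞)) (by simp)).clm_apply contDiff_const,
    hg.hasCompactSupport.fderiv_apply ℝ v,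
    fun _ hp => dirDeriv_eq_zero fun h => hp (hg.tsupport_subset h)⟩

lemma hasDerivAt_snd (hg : ConeSmooth g) (t r : ℝ) :
    HasDerivAt (fun r => g (t, r)) (dirDeriv (0, 1) g (t, r)) r :=
  ((hg.contDiff.differentiable (by simp) (t, r)).hasFDerivAt).comp_hasDerivAt r
    ((hasDerivAt_const r t).prodMk (hasDerivAt_id r))

lemma hasDerivAt_fst (hg : ConeSmooth g) (t r : ℝ) :
    HasDerivAt (fun t => g (t, r)) (dirDeriv (1, 0) g (t, r)) t :=
  ((hg.contDiff.differentiable (by simp) (t, r)).hasFDerivAt).comp_hasDerivAt t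
    ((hasDerivAt_id t).prodMk (hasDerivAt_const t r))

lemma apply_zero_right (hg : ConeSmooth g) (t : ℝ) : g (t, 0) = 0 := by
  have hc : Continuous fun r => g (t, r) := by
    have := hg.contDiff.continuous
    fun_prop
  have hcl : IsClosed {r : ℝ | g (t, r) = 0} := isClosed_eq hc continuous_const
  have hsub : Iio (0 : ℝ) ⊆ {r : ℝ | g (t, r) = 0} := fun r hr =>
    hg.eq_zero _ fun h => not_lt.mpr h.1 hr
  have := hcl.closure_subset_iff.mpr hsub
  rw [closure_Iio] at this
  exact this (mem_Iic.mpr le_rfl)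

/-- Functions supported in the cone vanish to infinite order at its boundary point `r = 0`. -/
lemma exists_abs_le_mul_pow (n : ℕ) :
    ∀ {g : ℝ × ℝ → ℝ}, ConeSmooth g →
      ∃ C : ℝ, 0 ≤ C ∧ ∀ t r : ℝ, 0 ≤ r → |g (t, r)| ≤ C * r ^ n := by
  induction n with
  | zero =>
    intro g hg
    obtain ⟨C, hC⟩ := hg.hasCompactSupport.exists_bound_of_continuous hg.contDiff.continuous
    exact ⟨C, (norm_nonneg _).trans (hC 0), fun t r _ => by simpa using hC (t, r)⟩
  | succ n ih =>
    intro g hg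
    obtain ⟨C, hC0, hC⟩ := ih (hg.dirDeriv_right (0, 1))
    refine ⟨C, hC0, fun t r hr => ?_⟩
    have h := (convex_Icc (0 : ℝ) r).norm_image_sub_le_of_norm_hasDerivWithin_le
      (f := fun r => g (t, r)) (f' := fun r => dirDeriv (0, 1) g (t, r)) (C := C * r ^ n)
      (fun x _ => (hg.hasDerivAt_snd t x).hasDerivWithinAt)
      (fun x hx => (hC t x hx.1).trans
        (mul_le_mul_of_nonneg_left (pow_le_pow_left₀ hx.1 hx.2 n) hC0))
      (left_mem_Icc.mpr hr) (right_mem_Icc.mpr hr)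
    simpa [hg.apply_zero_right t, abs_of_nonneg hr, pow_succ, mul_assoc] using h

lemma integrable_weighted (hg : ConeSmooth g) (s : ℝ) : Integrable (weighted s g) := by
  have hmeas : Measurable (weighted s g) :=
    (((measurable_snd.pow_const s)).mul hg.contDiff.continuous.measurable).indicator
      (measurableSet_lt measurable_const measurable_snd)
  obtain ⟨n, hn⟩ := exists_nat_ge (-s)
  obtain ⟨C, hC0, hC⟩ := exists_abs_le_mul_pow n hg
  obtain ⟨R, hR⟩ := hg.hasCompactSupport.isCompact.isBounded.subset_closedBall 0
  have hK : weighted s g = (tsupport g).indicator (weighted s g) := by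
    refine (indicator_eq_self.mpr fun p hp => ?_).symm
    by_contra h
    exact hp (weighted_of_eq_zero (image_eq_zero_of_notMem_tsupport h))
  rw [hK, integrable_indicator_iff (isClosed_tsupport g).measurableSet]
  have hfin : volume (tsupport g) < ⊤ := hg.hasCompactSupport.isCompact.measure_lt_top
  refine Measure.integrableOn_of_bounded (M := |R| ^ (s + n) * C) hfin.ne
    hmeas.aestronglyMeasurable ?_
  refine (ae_restrict_iff' (isClosed_tsupport g).measurableSet).mpr (ae_of_all _ fun p hp => ?_)
  rcases lt_or_ge 0 p.2 with h | h
  · have hpR : p.2 ≤ |R| := by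
      have h1 := hR hp
      rw [mem_closedBall_zero_iff] at h1
      exact (le_abs_self _).trans ((norm_snd_le p).trans (h1.trans (le_abs_self R)))
    rw [weighted_of_pos h, Real.norm_eq_abs, abs_mul, abs_of_pos (Real.rpow_pos_of_pos h s)]
    calc p.2 ^ s * |g p| ≤ p.2 ^ s * (C * p.2 ^ n) :=
          mul_le_mul_of_nonneg_left (hC p.1 p.2 h.le) (Real.rpow_nonneg h.le s)
      _ = p.2 ^ (s + n) * C := by rw [Real.rpow_add h, Real.rpow_natCast]; ring
      _ ≤ |R| ^ (s + n) * C :=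
          mul_le_mul_of_nonneg_right (Real.rpow_le_rpow h.le hpR (by linarith)) hC0
  · rw [weighted_of_nonpos h, norm_zero]
    positivity

lemma integral_weighted_dirDeriv_fst (hg : ConeSmooth g) (s : ℝ) :
    ∫ p, weighted s (dirDeriv (1, 0) g) p = 0 := by
  have hi := (hg.dirDeriv_right (1, 0)).integrable_weighted s
  have hj := hg.integrable_weighted s
  rw [Measure.volume_eq_prod] at hi hj ⊢
  rw [integral_prod_symm _ hi]
  refine integral_eq_zero_of_ae ?_
  filter_upwards [hi.prod_left_ae, hj.prod_left_ae] with r h1 h2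
  refine integral_eq_zero_of_hasDerivAt_of_integrable (fun t => ?_) h1 h2
  rcases lt_or_ge 0 r with hr | hr
  · simpa [weighted, hr] using (hg.hasDerivAt_fst t r).const_mul (r ^ s)
  · simpa [weighted, not_lt.mpr hr] using hasDerivAt_const t (0 : ℝ)

lemma integral_weighted_dirDeriv_snd (hg : ConeSmooth g) (s : ℝ) :
    ∫ p, (weighted s (dirDeriv (0, 1) g) p + s * weighted (s - 1) g p) = 0 := by
  have hi : Integrable fun p =>
      weighted s (dirDeriv (0, 1) g) p + s * weighted (s - 1) g p :=
    ((hg.dirDeriv_right (0, 1)).integrable_weighted s).add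
      ((hg.integrable_weighted (s - 1)).const_mul s)
  have hj := hg.integrable_weighted s
  rw [Measure.volume_eq_prod] at hi hj ⊢
  rw [integral_prod _ hi]
  refine integral_eq_zero_of_ae ?_
  have hne : ∀ᵐ t : ℝ, t ≠ 0 := by simp [ae_iff]
  filter_upwards [hi.prod_right_ae, hj.prod_right_ae, hne] with t h1 h2 ht
  refine integral_eq_zero_of_hasDerivAt_of_integrable (fun r => ?_) h1 h2
  rcases lt_or_ge 0 r with hr | hr
  · have h := (Real.hasDerivAt_rpow_const (p := s) (Or.inl hr.ne')).mul (hg.hasDerivAt_snd t r)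
    rw [weighted_of_pos hr, weighted_of_pos hr]
    refine (h.congr_of_eventuallyEq ?_).congr_deriv (by ring)
    filter_upwards [lt_mem_nhds hr] with x hx
    exact weighted_of_pos (p := (t, x)) hx
  · rw [weighted_of_nonpos hr, weighted_of_nonpos hr, mul_zero, add_zero]
    refine (hasDerivAt_const r (0 : ℝ)).congr_of_eventuallyEq ?_
    filter_upwards [gt_mem_nhds (hr.trans_lt (abs_pos.mpr ht))] with x hx
    refine weighted_of_eq_zero (hg.eq_zero _ fun h => ?_)
    exact not_le.mpr hx (abs_le.mpr ⟨h.2.1, h.2.2⟩)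

/-- The conjugated wave operator controls all weighted first order terms. -/
lemma integral_weighted_estimate {u : ℝ × ℝ → ℝ} (hu : ConeSmooth u) {γ : ℝ} (hγ : 0 ≤ γ) :
    2 * γ ^ 2 * (∫ p, weighted (-2 * γ - 4)
          (fun p => (p.2 * dirDeriv (0, 1) u p - γ * u p) ^ 2) p)
        + 2 * γ ^ 2 * (∫ p, weighted (-2 * γ - 4)
          (fun p => (p.2 * dirDeriv (1, 0) u p) ^ 2) p)
        + γ ^ 4 * (∫ p, weighted (-2 * γ - 4) (fun p => u p ^ 2) p)
      ≤ ∫ p, weighted (-2 * γ - 4) (fun p => (p.2 * (p.2 *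
          (dirDeriv (0, 1) (dirDeriv (0, 1) u) p
            - dirDeriv (1, 0) (dirDeriv (1, 0) u) p))) ^ 2) p := by
  set ur := dirDeriv (0, 1) u with hur
  set ut := dirDeriv (1, 0) u with hut
  have cr : ConeSmooth ur := hu.dirDeriv_right _
  have ct : ConeSmooth ut := hu.dirDeriv_right _
  have c1 := (cr.snd_mul.sub (hu.const_mul γ)).sq
  have c2 := ct.snd_mul.sq
  have c3 := hu.sq
  have c0 := ((cr.dirDeriv_right (0, 1)).sub (ct.dirDeriv_right (1, 0))).snd_mul.snd_mul.sq
  have cx := ((c1.add c2).const_mul (2 * γ)).add ((hu.mul cr).snd_mul.const_mul (2 * γ ^ 2))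
  have cy := ((cr.mul ct).snd_mul.snd_mul.const_mul (-4 * γ)).add
    ((hu.mul ct).snd_mul.const_mul (2 * γ ^ 2))
  set x : ℝ × ℝ → ℝ := fun p =>
    2 * γ * ((p.2 * ur p - γ * u p) ^ 2 + (p.2 * ut p) ^ 2) + 2 * γ ^ 2 * (p.2 * (u p * ur p))
    with hx
  set y : ℝ × ℝ → ℝ := fun p =>
    -4 * γ * (p.2 * (p.2 * (ur p * ut p))) + 2 * γ ^ 2 * (p.2 * (u p * ut p))
  have hxr : ∀ p : ℝ × ℝ, dirDeriv (0, 1) x p =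
      2 * γ * (2 * (p.2 * ur p - γ * u p)
          * (ur p + p.2 * dirDeriv (0, 1) ur p - γ * ur p)
        + 2 * (p.2 * ut p) * (ut p + p.2 * dirDeriv (0, 1) ut p))
      + 2 * γ ^ 2 * (u p * ur p + p.2 * (ur p * ur p + u p * dirDeriv (0, 1) ur p)) := by
    rintro ⟨t, r⟩
    have hu' := hu.hasDerivAt_snd t r
    have hr' := cr.hasDerivAt_snd t r
    have ht' := ct.hasDerivAt_snd t r
    have hid := hasDerivAt_id' r
    have h := ((((((hid.mul hr').sub (hu'.const_mul γ)).pow 2).add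
      ((hid.mul ht').pow 2)).const_mul (2 * γ)).add
      ((hid.mul (hu'.mul hr')).const_mul (2 * γ ^ 2)))
    refine ((cx.hasDerivAt_snd t r).unique h).trans ?_
    simp only [Pi.mul_apply, Pi.sub_apply, ← hur]
    push_cast
    ring
  have hyt : ∀ p : ℝ × ℝ, dirDeriv (1, 0) y p =
      -4 * γ * (p.2 * (p.2 * (dirDeriv (1, 0) ur p * ut p
        + ur p * dirDeriv (1, 0) ut p)))
      + 2 * γ ^ 2 * (p.2 * (ut p * ut p + u p * dirDeriv (1, 0) ut p)) := by
    rintro ⟨t, r⟩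
    have hu' := hu.hasDerivAt_fst t r
    have hr' := cr.hasDerivAt_fst t r
    have ht' := ct.hasDerivAt_fst t r
    exact (cy.hasDerivAt_fst t r).unique
      (((((hr'.mul ht').const_mul r).const_mul r).const_mul (-4 * γ)).add
        (((hu'.mul ht').const_mul r).const_mul (2 * γ ^ 2)))
  have hix := cx.integral_weighted_dirDeriv_snd (-2 * γ - 3)
  have hiy := cy.integral_weighted_dirDeriv_fst (-2 * γ - 3)
  have ix : Integrable fun p => weighted (-2 * γ - 3) (dirDeriv (0, 1) x) p
      + (-2 * γ - 3) * weighted (-2 * γ - 3 - 1) x p :=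
    ((cx.dirDeriv_right (0, 1)).integrable_weighted _).add ((cx.integrable_weighted _).const_mul _)
  have iy := (cy.dirDeriv_right (1, 0)).integrable_weighted (-2 * γ - 3)
  have i1 := (c1.integrable_weighted (-2 * γ - 4)).const_mul (2 * γ ^ 2)
  have i2 := (c2.integrable_weighted (-2 * γ - 4)).const_mul (2 * γ ^ 2)
  have i3 := (c3.integrable_weighted (-2 * γ - 4)).const_mul (γ ^ 4)
  have i0 := c0.integrable_weighted (-2 * γ - 4)
  have h12 := integral_add i1 i2
  have h123 := integral_add (i1.add i2) i3
  have hxy := integral_add ix iy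
  have hall := integral_add ((i1.add i2).add i3) (ix.add iy)
  simp only [Pi.add_apply] at h123 hall
  rw [hix, hiy, add_zero] at hxy
  rw [hxy, add_zero, h123, h12, integral_const_mul, integral_const_mul, integral_const_mul] at hall
  rw [← hall]
  refine integral_mono (((i1.add i2).add i3).add (ix.add iy)) i0 fun p => ?_
  simp only
  rcases lt_or_ge 0 p.2 with hp | hp
  · simp only [weighted_of_pos hp]
    have e : p.2 ^ (-2 * γ - 3) = p.2 ^ (-2 * γ - 4) * p.2 := by
      rw [← Real.rpow_add_one hp.ne']
      congr 1
      ring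
    have e' : (-2 * γ - 3 - 1 : ℝ) = -2 * γ - 4 := by ring
    have hsymm : dirDeriv (0, 1) ut p = dirDeriv (1, 0) ur p :=
      dirDeriv_comm hu.contDiff _ _ p
    rw [e', e, hxr, hyt, hsymm, hx]
    have hw : 0 ≤ p.2 ^ (-2 * γ - 4) := Real.rpow_nonneg hp.le _
    rw [← sub_nonneg]
    refine (mul_nonneg hw (?_ : 0 ≤
      (p.2 ^ 2 * (dirDeriv (0, 1) ur p - dirDeriv (1, 0) ut p)
          - 2 * γ * (p.2 * ur p - γ * u p) - γ ^ 2 * u p) ^ 2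
        + 2 * γ * (p.2 * ur p - γ * u p) ^ 2 + 2 * γ * (p.2 * ut p) ^ 2
        + 4 * γ ^ 3 * u p ^ 2)).trans_eq ?_
    · positivity
    · ring
  · simp [weighted_of_nonpos hp]

end ConeSmooth

lemma integral_weighted_nonneg {s : ℝ} {g : ℝ × ℝ → ℝ} (hg : ∀ p, 0 ≤ g p) :
    0 ≤ ∫ p, weighted s g p :=
  integral_nonneg fun p => weighted_nonneg hg p

lemma ofReal_integral_le_lintegral_ofReal {α : Type*} [MeasurableSpace α] {μ : Measure α}
    {f : α → ℝ} (hf : Integrable f μ) :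
    ENNReal.ofReal (∫ a, f a ∂μ) ≤ ∫⁻ a, ENNReal.ofReal (f a) ∂μ := by
  rw [integral_eq_lintegral_pos_part_sub_lintegral_neg_part hf]
  exact (ENNReal.ofReal_le_ofReal (sub_le_self _ ENNReal.toReal_nonneg)).trans
    ENNReal.ofReal_toReal_le

lemma lintegral_ofReal_weighted {g : ℝ × ℝ → ℝ} (hg : ConeSmooth g) (h0 : ∀ p, 0 ≤ g p) (s : ℝ) :
    ∫⁻ p, ENNReal.ofReal (weighted s g p) = ENNReal.ofReal (∫ p, weighted s g p) :=
  (ofReal_integral_eq_lintegral_ofReal (hg.integrable_weighted s)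
    (ae_of_all _ (weighted_nonneg h0))).symm

lemma setLIntegral_le_ofReal_integral_weighted {g f : ℝ × ℝ → ℝ} (hg : ConeSmooth g)
    (h0 : ∀ p, 0 ≤ g p) (s : ℝ) (U : Set (ℝ × ℝ))
    (hpos : ∀ p : ℝ × ℝ, 0 < p.2 → f p = p.2 ^ s * g p)
    (hneg : ∀ p : ℝ × ℝ, p.2 < 0 → f p = 0) :
    ∫⁻ p in U, ENNReal.ofReal (f p) ≤ ENNReal.ofReal (∫ p, weighted s g p) := by
  rw [← lintegral_ofReal_weighted hg h0 s]
  refine (setLIntegral_le_lintegral U _).trans (lintegral_mono_ae ?_)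
  have hne : ∀ᵐ p : ℝ × ℝ, p.2 ≠ 0 := by
    rw [Measure.volume_eq_prod]
    exact Measure.quasiMeasurePreserving_snd.ae
      (p := fun r : ℝ => r ≠ 0) (by simp [ae_iff])
  filter_upwards [hne] with p hp
  rcases lt_or_gt_of_ne hp with h | h
  · rw [hneg p h, weighted_of_nonpos h.le]
  · rw [hpos p h, weighted_of_pos h]

lemma rpow_neg_sub_two_mul_sq {r : ℝ} (hr : 0 < r) (γ x : ℝ) :
    (r ^ (-γ - 2) * x) ^ 2 = r ^ (-2 * γ - 4) * x ^ 2 := by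
  rw [mul_pow, ← Real.rpow_mul_natCast hr.le]
  congr 2
  push_cast
  ring

/-- the Carleman estimate with weight `r^{−γ}`. Coordinates on `ℝ²` are
`(τ,r) = (p.1, p.2)`, and `P u = r² ∂_r² u − r² ∂_τ² u + F u`. There is a constant `C > 0`
independent of `F` and of the bound `M`, and for each `M` a `γ₀ > 0`, such that for all
`γ ≥ γ₀` and all smooth `u` compactly supported in `U` inside the cone
`{r ≥ 0, −r ≤ τ ≤ r}`:
`‖r^{−γ−2} P u‖² ≥ C (γ² ‖r^{−1} ∂_r(r^{−γ}u)‖² + γ² ‖r^{−1−γ} ∂_τ u‖² + γ⁴ ‖r^{−γ−2} u‖²)`,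
with `L²` norms on `U`. -/
theorem stmt11 (U : Set (ℝ × ℝ)) (hU : IsOpen U) (h0 : ((0 : ℝ), (0 : ℝ)) ∈ U) :
    ∃ C : ℝ, 0 < C ∧
      ∀ M : ℝ, 0 < M → ∃ γ₀ : ℝ, 0 < γ₀ ∧
        ∀ F : ℝ × ℝ → ℝ, ContDiffOn ℝ 1 F U →
          (∀ p ∈ U, |F p| ≤ M ∧ |p.2 * deriv (fun r => F (p.1, r)) p.2| ≤ M) →
          ∀ γ : ℝ, γ₀ ≤ γ →
            ∀ u : ℝ × ℝ → ℝ, ContDiff ℝ (⊤ : ℕ∞) u → HasCompactSupport u → tsupport u ⊆ U →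
              tsupport u ⊆ {p : ℝ × ℝ | 0 ≤ p.2 ∧ -p.2 ≤ p.1 ∧ p.1 ≤ p.2} →
              ENNReal.ofReal C *
                  (ENNReal.ofReal (γ ^ 2) *
                      (∫⁻ p in U, ENNReal.ofReal
                        ((p.2 ^ (-1 : ℝ) * deriv (fun r => r ^ (-γ) * u (p.1, r)) p.2) ^ 2))
                    + ENNReal.ofReal (γ ^ 2) *
                      (∫⁻ p in U, ENNReal.ofReal
                        ((p.2 ^ (-1 - γ) * deriv (fun t => u (t, p.2)) p.1) ^ 2))
                    + ENNReal.ofReal (γ ^ 4) *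
                      (∫⁻ p in U, ENNReal.ofReal ((p.2 ^ (-γ - 2) * u p) ^ 2)))
                ≤ ∫⁻ p in U, ENNReal.ofReal
                    ((p.2 ^ (-γ - 2) *
                      (p.2 ^ 2 * iteratedDeriv 2 (fun r => u (p.1, r)) p.2
                        - p.2 ^ 2 * iteratedDeriv 2 (fun t => u (t, p.2)) p.1
                        + F p * u p)) ^ 2) := by
  refine ⟨1 / 4, by norm_num, fun M hM => ⟨1 + 2 * M, by positivity, ?_⟩⟩
  intro F _ hF γ hγ u hu hcs hsU hcone
  have hγ1 : 1 ≤ γ := by linarith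
  have hγM : 4 * M ^ 2 ≤ γ ^ 4 := by nlinarith [pow_le_pow_right₀ hγ1 (show 2 ≤ 4 by norm_num)]
  have cu : ConeSmooth u := ⟨hu, hcs, fun p hp =>
    image_eq_zero_of_notMem_tsupport fun h => hp (hcone h)⟩
  have cr := cu.dirDeriv_right (0, 1)
  have ct := cu.dirDeriv_right (1, 0)
  have crr := cr.dirDeriv_right (0, 1)
  have ctt := ct.dirDeriv_right (1, 0)
  have c1 := (cr.snd_mul.sub (cu.const_mul γ)).sq
  have c2 := ct.snd_mul.sq
  have c3 := cu.sq
  have c0 := (crr.sub ctt).snd_mul.snd_mul.sq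
  have hneg : ∀ {p : ℝ × ℝ}, p.2 < 0 → u p = 0 := fun {p} hp =>
    cu.eq_zero p fun h => not_lt.mpr h.1 hp
  have hrr : ∀ p : ℝ × ℝ, iteratedDeriv 2 (fun r => u (p.1, r)) p.2
      = dirDeriv (0, 1) (dirDeriv (0, 1) u) p := by
    intro p
    have h : deriv (fun r => u (p.1, r)) = fun r => dirDeriv (0, 1) u (p.1, r) :=
      funext fun r => (cu.hasDerivAt_snd p.1 r).deriv
    rw [iteratedDeriv_succ, iteratedDeriv_one, h]
    exact (cr.hasDerivAt_snd p.1 p.2).deriv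
  have htt : ∀ p : ℝ × ℝ, iteratedDeriv 2 (fun t => u (t, p.2)) p.1
      = dirDeriv (1, 0) (dirDeriv (1, 0) u) p := by
    intro p
    have h : deriv (fun t => u (t, p.2)) = fun t => dirDeriv (1, 0) u (t, p.2) :=
      funext fun t => (cu.hasDerivAt_fst t p.2).deriv
    rw [iteratedDeriv_succ, iteratedDeriv_one, h]
    exact (ct.hasDerivAt_fst p.1 p.2).deriv
  have ht : ∀ p : ℝ × ℝ, deriv (fun t => u (t, p.2)) p.1 = dirDeriv (1, 0) u p := fun p =>
    (cu.hasDerivAt_fst p.1 p.2).deriv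
  have b1 := setLIntegral_le_ofReal_integral_weighted
    (f := fun p => (p.2 ^ (-1 : ℝ) * deriv (fun r => r ^ (-γ) * u (p.1, r)) p.2) ^ 2)
    c1 (fun p => sq_nonneg _) (-2 * γ - 4) U
    (by
      intro p hp
      have h := (Real.hasDerivAt_rpow_const (p := -γ) (Or.inl hp.ne')).mul
        (cu.hasDerivAt_snd p.1 p.2)
      have e1 : p.2 ^ (-γ - 1) = p.2 ^ (-γ - 2) * p.2 := by
        rw [← Real.rpow_add_one hp.ne']; ring_nf
      have e2 : p.2 ^ (-γ) = p.2 ^ (-γ - 2) * p.2 * p.2 := by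
        rw [← Real.rpow_add_one hp.ne', ← Real.rpow_add_one hp.ne']; ring_nf
      have h' : deriv (fun r => r ^ (-γ) * u (p.1, r)) p.2
          = -γ * p.2 ^ (-γ - 1) * u p + p.2 ^ (-γ) * dirDeriv (0, 1) u p := h.deriv
      rw [← rpow_neg_sub_two_mul_sq hp, h', Real.rpow_neg_one, e1, e2]
      congr 1
      field_simp
      ring)
    (by
      intro p hp
      have h : deriv (fun r => r ^ (-γ) * u (p.1, r)) p.2 = 0 := by
        refine HasDerivAt.deriv ((hasDerivAt_const p.2 (0 : ℝ)).congr_of_eventuallyEq ?_)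
        filter_upwards [gt_mem_nhds hp] with r hr
        rw [hneg (p := (p.1, r)) hr, mul_zero]
      simp [h])
  have b2 := setLIntegral_le_ofReal_integral_weighted
    (f := fun p => (p.2 ^ (-1 - γ) * deriv (fun t => u (t, p.2)) p.1) ^ 2)
    c2 (fun p => sq_nonneg _) (-2 * γ - 4) U
    (by
      intro p hp
      have e1 : p.2 ^ (-1 - γ) = p.2 ^ (-γ - 2) * p.2 := by
        rw [← Real.rpow_add_one hp.ne']; ring_nf
      rw [← rpow_neg_sub_two_mul_sq hp, ht, e1, mul_assoc])
    (by
      intro p hp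
      have h : dirDeriv (1, 0) u p = 0 := ct.eq_zero p fun h => not_lt.mpr h.1 hp
      simp [ht, h])
  have b3 := setLIntegral_le_ofReal_integral_weighted
    (f := fun p => (p.2 ^ (-γ - 2) * u p) ^ 2)
    c3 (fun p => sq_nonneg _) (-2 * γ - 4) U
    (fun p hp => (rpow_neg_sub_two_mul_sq hp γ _))
    (fun p hp => by simp [hneg hp])
  have key := cu.integral_weighted_estimate (zero_le_one.trans hγ1)
  have n1 := integral_weighted_nonneg (s := -2 * γ - 4)
    (g := fun p => (p.2 * dirDeriv (0, 1) u p - γ * u p) ^ 2) (fun p => sq_nonneg _)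
  have n2 := integral_weighted_nonneg (s := -2 * γ - 4)
    (g := fun p => (p.2 * dirDeriv (1, 0) u p) ^ 2) (fun p => sq_nonneg _)
  have n3 := integral_weighted_nonneg (s := -2 * γ - 4)
    (g := fun p => u p ^ 2) (fun p => sq_nonneg _)
  have i0 := c0.integrable_weighted (-2 * γ - 4)
  have i3 := c3.integrable_weighted (-2 * γ - 4)
  have hdiff := integral_sub (i0.const_mul (1 / 2)) (i3.const_mul (M ^ 2))
  rw [integral_const_mul, integral_const_mul] at hdiff
  set I1 := ∫ p, weighted (-2 * γ - 4) (fun p => (p.2 * dirDeriv (0, 1) u p - γ * u p) ^ 2) p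
  set I2 := ∫ p, weighted (-2 * γ - 4) (fun p => (p.2 * dirDeriv (1, 0) u p) ^ 2) p
  set I3 := ∫ p, weighted (-2 * γ - 4) (fun p => u p ^ 2) p
  have hlow : 1 / 4 * (γ ^ 2 * I1 + γ ^ 2 * I2 + γ ^ 4 * I3) ≤ ∫ p,
      (1 / 2 * weighted (-2 * γ - 4) (fun p => (p.2 * (p.2 *
          (dirDeriv (0, 1) (dirDeriv (0, 1) u) p
            - dirDeriv (1, 0) (dirDeriv (1, 0) u) p))) ^ 2) p
        - M ^ 2 * weighted (-2 * γ - 4) (fun p => u p ^ 2) p) := by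
    rw [hdiff]
    have := mul_le_mul_of_nonneg_right hγM n3
    have := mul_nonneg (sq_nonneg γ) n1
    have := mul_nonneg (sq_nonneg γ) n2
    linarith
  calc _ ≤ ENNReal.ofReal (1 / 4) * (ENNReal.ofReal (γ ^ 2) * ENNReal.ofReal I1
          + ENNReal.ofReal (γ ^ 2) * ENNReal.ofReal I2
          + ENNReal.ofReal (γ ^ 4) * ENNReal.ofReal I3) := by gcongr
    _ = ENNReal.ofReal (1 / 4 * (γ ^ 2 * I1 + γ ^ 2 * I2 + γ ^ 4 * I3)) := by
      rw [ENNReal.ofReal_mul (by norm_num), ENNReal.ofReal_add (by positivity) (by positivity),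
        ENNReal.ofReal_add (by positivity) (by positivity), ENNReal.ofReal_mul (by positivity),
        ENNReal.ofReal_mul (by positivity), ENNReal.ofReal_mul (by positivity)]
    _ ≤ _ := ENNReal.ofReal_le_ofReal hlow
    _ ≤ _ := ofReal_integral_le_lintegral_ofReal ((i0.const_mul (1 / 2)).sub (i3.const_mul (M ^ 2)))
    _ ≤ _ := by
      rw [← lintegral_indicator hU.measurableSet]
      refine lintegral_mono fun p => ?_
      by_cases hpU : p ∈ U
      · rw [indicator_of_mem hpU]
        refine ENNReal.ofReal_le_ofReal ?_
        rcases lt_or_ge 0 p.2 with hp | hp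
        · rw [weighted_of_pos hp, weighted_of_pos hp, rpow_neg_sub_two_mul_sq hp, hrr, htt]
          have hw : 0 ≤ p.2 ^ (-2 * γ - 4) := Real.rpow_nonneg hp.le _
          have hFM : F p ^ 2 * u p ^ 2 ≤ M ^ 2 * u p ^ 2 :=
            mul_le_mul_of_nonneg_right (sq_le_sq' (abs_le.mp (hF p hpU).1).1
              (abs_le.mp (hF p hpU).1).2) (sq_nonneg _)
          set D := dirDeriv (0, 1) (dirDeriv (0, 1) u) p - dirDeriv (1, 0) (dirDeriv (1, 0) u) p
            with hD
          have h : 1 / 2 * (p.2 * (p.2 * D)) ^ 2 - M ^ 2 * u p ^ 2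
              ≤ (p.2 ^ 2 * dirDeriv (0, 1) (dirDeriv (0, 1) u) p
                - p.2 ^ 2 * dirDeriv (1, 0) (dirDeriv (1, 0) u) p + F p * u p) ^ 2 := by
            rw [← mul_sub, ← hD]
            nlinarith [sq_nonneg (p.2 ^ 2 * D + 2 * (F p * u p))]
          refine le_trans (le_of_eq ?_) (mul_le_mul_of_nonneg_left h hw)
          ring
        · rw [weighted_of_nonpos hp, weighted_of_nonpos hp, mul_zero, mul_zero, sub_zero]
          exact sq_nonneg _
      · have h1 : p ∉ tsupport u := fun h => hpU (hsU h)
        have hz : ∀ v : ℝ × ℝ, dirDeriv v (dirDeriv v u) p = 0 := fun v =>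
          dirDeriv_eq_zero fun h => h1 (tsupport_dirDeriv_subset v u h)
        rw [indicator_of_notMem hpU, weighted_of_eq_zero (by simp [hz]),
          weighted_of_eq_zero (by simp [image_eq_zero_of_notMem_tsupport h1])]
        simp
end

section
/- Let v be a C^∞ function on ℝ² (coordinates (τ,r)) with compact support contained in the cone {(τ,r) : r ≥ 0 and −r ≤ τ ≤ r}. Then ∫_{ℝ²} ( ∂_r² v − ∂_τ² v ) r^{−1} ∂_r v dτ dr = (1/2) ∫_{ℝ²} r^{−2} (∂_r v)² dτ dr + (1/2) ∫_{ℝ²} r^{−2} (∂_τ v)² dτ dr. -/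
open MeasureTheory Set

/-- The closed cone `{(τ, r) | 0 ≤ r, |τ| ≤ r}`. -/
def closedCone : Set (ℝ × ℝ) := {p : ℝ × ℝ | 0 ≤ p.2 ∧ -p.2 ≤ p.1 ∧ p.1 ≤ p.2}

/-- Smooth compactly supported functions with support in the closed cone. -/
structure IsConeTest (f : ℝ × ℝ → ℝ) : Prop where
  contDiff : ContDiff ℝ (⊤ : ℕ∞) f
  hasCompactSupport : HasCompactSupport f
  tsupport_subset : tsupport f ⊆ closedCone

/-- The derivative of `f` in the direction `w`. -/
noncomputable def derivAlong (w : ℝ × ℝ) (f : ℝ × ℝ → ℝ) (p : ℝ × ℝ) : ℝ := fderiv ℝ f p w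

namespace IsConeTest

variable {f g : ℝ × ℝ → ℝ}

theorem isConeTest_derivAlong (hf : IsConeTest f) (w : ℝ × ℝ) : IsConeTest (derivAlong w f) where
  contDiff := (hf.contDiff.fderiv_right (m := (⊤ : ℕ∞)) (by simp)).clm_apply contDiff_const
  hasCompactSupport := hf.hasCompactSupport.fderiv_apply ℝ w
  tsupport_subset := (tsupport_fderiv_apply_subset ℝ w).trans hf.tsupport_subset

theorem differentiable (hf : IsConeTest f) : Differentiable ℝ f :=
  hf.contDiff.differentiable (by simp)

theorem hasDerivAt_snd (hf : IsConeTest f) (t r : ℝ) :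
    HasDerivAt (fun x => f (t, x)) (derivAlong (0, 1) f (t, r)) r :=
  (hf.differentiable (t, r)).hasFDerivAt.comp_hasDerivAt r
    ((hasDerivAt_const r t).prodMk (hasDerivAt_id r))

theorem hasDerivAt_fst (hf : IsConeTest f) (t r : ℝ) :
    HasDerivAt (fun x => f (x, r)) (derivAlong (1, 0) f (t, r)) t :=
  HasFDerivAt.comp_hasDerivAt (f := fun x : ℝ => (x, r)) t
    (hf.differentiable (t, r)).hasFDerivAt
    ((hasDerivAt_id t).prodMk (hasDerivAt_const t r))

theorem iteratedDeriv_two_snd (hf : IsConeTest f) (t r : ℝ) :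
    iteratedDeriv 2 (fun x => f (t, x)) r =
      derivAlong (0, 1) (derivAlong (0, 1) f) (t, r) := by
  rw [iteratedDeriv_succ, iteratedDeriv_one,
    funext fun x => (hf.hasDerivAt_snd t x).deriv]
  exact ((hf.isConeTest_derivAlong _).hasDerivAt_snd t r).deriv

theorem iteratedDeriv_two_fst (hf : IsConeTest f) (t r : ℝ) :
    iteratedDeriv 2 (fun x => f (x, r)) t =
      derivAlong (1, 0) (derivAlong (1, 0) f) (t, r) := by
  rw [iteratedDeriv_succ, iteratedDeriv_one,
    funext fun x => (hf.hasDerivAt_fst x r).deriv]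
  exact ((hf.isConeTest_derivAlong _).hasDerivAt_fst t r).deriv

theorem derivAlong_comm (hf : IsConeTest f) (w z p : ℝ × ℝ) :
    derivAlong w (derivAlong z f) p = derivAlong z (derivAlong w f) p := by
  have hd : DifferentiableAt ℝ (fderiv ℝ f) p :=
    ((hf.contDiff.fderiv_right (m := (⊤ : ℕ∞)) (by simp)).differentiable (by simp)) p
  have key (a b : ℝ × ℝ) :
      derivAlong a (derivAlong b f) p = fderiv ℝ (fderiv ℝ f) p a b := by
    have h := (hd.hasFDerivAt.clm_apply (hasFDerivAt_const b p)).fderiv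
    change fderiv ℝ (fun q => fderiv ℝ f q b) p a = _
    rw [h]
    simp
  rw [key, key]
  exact (hf.contDiff.contDiffAt.isSymmSndFDerivAt (by simpa using WithTop.coe_le_coe.2 (le_top : (2 : ℕ∞) ≤ ⊤))) w z

theorem eq_zero_of_notMem (hf : IsConeTest f) {p : ℝ × ℝ} (hp : p ∉ closedCone) : f p = 0 :=
  image_eq_zero_of_notMem_tsupport fun h => hp (hf.tsupport_subset h)

theorem apply_snd_zero (hf : IsConeTest f) (t : ℝ) : f (t, 0) = 0 := by
  have hc : Continuous fun x => f (t, x) := hf.contDiff.continuous.comp (by fun_prop)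
  have hcl : IsClosed {x : ℝ | f (t, x) = 0} := isClosed_eq hc continuous_const
  have hsub : Iio (0 : ℝ) ⊆ {x : ℝ | f (t, x) = 0} := fun x hx =>
    hf.eq_zero_of_notMem fun h => absurd h.1 (not_le.2 hx)
  have h0 : (0 : ℝ) ∈ closure (Iio (0 : ℝ)) := by simp
  exact closure_minimal hsub hcl h0

theorem exists_abs_div_snd_le (hf : IsConeTest f) : ∃ C : ℝ, ∀ p, ‖f p / p.2‖ ≤ C := by
  obtain ⟨C, hC⟩ := (hf.contDiff.of_le (m := 1)
    (by exact_mod_cast le_top)).lipschitzWith_of_hasCompactSupport hf.hasCompactSupport (by simp)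
  refine ⟨C, fun ⟨t, r⟩ => ?_⟩
  have h := hC.dist_le_mul (t, r) (t, 0)
  rw [hf.apply_snd_zero, Prod.dist_eq] at h
  simp only [dist_self, Real.dist_eq, sub_zero, abs_nonneg, sup_of_le_right] at h
  rw [norm_div, Real.norm_eq_abs, Real.norm_eq_abs]
  exact div_le_of_le_mul₀ (abs_nonneg _) C.2 h

theorem measurable_div_snd (hf : IsConeTest f) : Measurable fun p : ℝ × ℝ => f p / p.2 :=
  hf.contDiff.continuous.measurable.div measurable_snd

theorem integrable_mul_div (hf : IsConeTest f) (hg : IsConeTest g) :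
    Integrable fun p : ℝ × ℝ => f p * (g p / p.2) := by
  obtain ⟨C, hC⟩ := hg.exists_abs_div_snd_le
  exact (hf.contDiff.continuous.integrable_of_hasCompactSupport hf.hasCompactSupport).mul_bdd
    (c := C) hg.measurable_div_snd.aestronglyMeasurable (Filter.Eventually.of_forall hC)

theorem integrable_div_snd (hf : IsConeTest f) : Integrable fun p : ℝ × ℝ => f p / p.2 := by
  obtain ⟨C, hC⟩ := hf.exists_abs_div_snd_le
  rw [← integrableOn_iff_integrable_of_support_subset (s := tsupport f)]
  · exact Measure.integrableOn_of_bounded (M := C) hf.hasCompactSupport.isCompact.measure_lt_top.ne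
      hf.measurable_div_snd.aestronglyMeasurable (Filter.Eventually.of_forall hC)
  · intro p hp
    refine subset_tsupport f fun h => hp ?_
    simp [h]

theorem integrable_div_mul_div (hf : IsConeTest f) (hg : IsConeTest g) :
    Integrable fun p : ℝ × ℝ => f p / p.2 * (g p / p.2) := by
  obtain ⟨C, hC⟩ := hg.exists_abs_div_snd_le
  exact hf.integrable_div_snd.mul_bdd
    (c := C) hg.measurable_div_snd.aestronglyMeasurable (Filter.Eventually.of_forall hC)

theorem eventually_eq_zero (hf : IsConeTest f) {t : ℝ} (ht : t ≠ 0) :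
    ∀ᶠ r in nhds (0 : ℝ), f (t, r) = 0 := by
  filter_upwards [Metric.ball_mem_nhds (0 : ℝ) (abs_pos.2 ht)] with r hr
  rw [Metric.mem_ball, Real.dist_eq, sub_zero] at hr
  refine hf.eq_zero_of_notMem fun h => ?_
  exact absurd (abs_le.2 h.2) (not_le.2 ((le_abs_self r).trans_lt hr))

theorem hasDerivAt_mul_div_snd (hf : IsConeTest f) (hg : IsConeTest g) {t : ℝ} (ht : t ≠ 0)
    (r : ℝ) :
    HasDerivAt (fun x => f (t, x) * (g (t, x) / x))
      (derivAlong (0, 1) f (t, r) * (g (t, r) / r)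
        + derivAlong (0, 1) g (t, r) * (f (t, r) / r)
        - f (t, r) / r * (g (t, r) / r)) r := by
  rcases eq_or_ne r 0 with rfl | hr
  · simp only [div_zero, mul_zero, add_zero, sub_zero]
    refine (hasDerivAt_const (0 : ℝ) (0 : ℝ)).congr_of_eventuallyEq ?_
    filter_upwards [hf.eventually_eq_zero ht] with x hx
    simp [hx]
  · refine ((hf.hasDerivAt_snd t r).mul
      ((hg.hasDerivAt_snd t r).div (hasDerivAt_id' r) hr)).congr_deriv ?_
    simp only [Pi.div_apply]
    field_simp
    ring

theorem integral_snd_deriv (hf : IsConeTest f) (hg : IsConeTest g) :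
    ∫ p : ℝ × ℝ, (derivAlong (0, 1) f p * (g p / p.2)
      + derivAlong (0, 1) g p * (f p / p.2) - f p / p.2 * (g p / p.2)) = 0 := by
  have hint := (((hf.isConeTest_derivAlong (0, 1)).integrable_mul_div hg).add
    ((hg.isConeTest_derivAlong (0, 1)).integrable_mul_div hf)).sub (hf.integrable_div_mul_div hg)
  have hprim := hf.integrable_mul_div hg
  rw [Measure.volume_eq_prod] at hint hprim ⊢
  refine (integral_prod _ hint).trans (integral_eq_zero_of_ae ?_)
  filter_upwards [hint.prod_right_ae, hprim.prod_right_ae, Measure.ae_ne volume 0] with t h₁ h₂ ht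
  exact integral_eq_zero_of_hasDerivAt_of_integrable (hf.hasDerivAt_mul_div_snd hg ht) h₁ h₂

theorem integral_fst_deriv (hf : IsConeTest f) (hg : IsConeTest g) :
    ∫ p : ℝ × ℝ, (derivAlong (1, 0) f p * (g p / p.2)
      + derivAlong (1, 0) g p * (f p / p.2)) = 0 := by
  have hint := ((hf.isConeTest_derivAlong (1, 0)).integrable_mul_div hg).add
    ((hg.isConeTest_derivAlong (1, 0)).integrable_mul_div hf)
  have hprim := hf.integrable_mul_div hg
  rw [Measure.volume_eq_prod] at hint hprim ⊢
  refine (integral_prod_symm _ hint).trans (integral_eq_zero_of_ae ?_)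
  filter_upwards [hint.prod_left_ae, hprim.prod_left_ae] with r h₁ h₂
  refine integral_eq_zero_of_hasDerivAt_of_integrable (fun t => ?_) h₁ h₂
  refine ((hf.hasDerivAt_fst t r).mul ((hg.hasDerivAt_fst t r).div_const r)).congr_deriv ?_
  rw [Pi.add_apply]
  ring

theorem integral_snd_deriv_mul_self (hf : IsConeTest f) :
    ∫ p : ℝ × ℝ, derivAlong (0, 1) f p * (f p / p.2) =
      (1 / 2) * ∫ p : ℝ × ℝ, f p / p.2 * (f p / p.2) := by
  have h := hf.integral_snd_deriv hf
  have h₁ := (hf.isConeTest_derivAlong (0, 1)).integrable_mul_div hf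
  have h₂ := integral_sub (h₁.add h₁) (hf.integrable_div_mul_div hf)
  simp only [Pi.add_apply] at h₂
  rw [h₂, integral_add h₁ h₁] at h
  linarith

end IsConeTest

/-- for `v` smooth with compact support in the cone `{r ≥ 0, −r ≤ τ ≤ r}`
(coordinates `(τ,r) = (p.1, p.2)`):
`∫ (∂_r² v − ∂_τ² v) r^{−1} ∂_r v dτ dr
  = (1/2) ∫ r^{−2} (∂_r v)² dτ dr + (1/2) ∫ r^{−2} (∂_τ v)² dτ dr`. -/
theorem stmt13 (v : ℝ × ℝ → ℝ) (hv : ContDiff ℝ (⊤ : ℕ∞) v) (hc : HasCompactSupport v)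
    (hsupp : tsupport v ⊆ {p : ℝ × ℝ | 0 ≤ p.2 ∧ -p.2 ≤ p.1 ∧ p.1 ≤ p.2}) :
    (∫ p : ℝ × ℝ,
        (iteratedDeriv 2 (fun r => v (p.1, r)) p.2 - iteratedDeriv 2 (fun t => v (t, p.2)) p.1)
          * (p.2 ^ (-1 : ℝ) * deriv (fun r => v (p.1, r)) p.2))
      = (1 / 2) * (∫ p : ℝ × ℝ, p.2 ^ (-2 : ℝ) * (deriv (fun r => v (p.1, r)) p.2) ^ 2)
        + (1 / 2) * ∫ p : ℝ × ℝ, p.2 ^ (-2 : ℝ) * (deriv (fun t => v (t, p.2)) p.1) ^ 2 := by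
  have hf : IsConeTest v := ⟨hv, hc, hsupp⟩
  have ha := hf.isConeTest_derivAlong (0, 1)
  have hb := hf.isConeTest_derivAlong (1, 0)
  have hpow (x : ℝ) : x ^ (-2 : ℝ) = (x ^ 2)⁻¹ := by
    rw [show (-2 : ℝ) = ((-2 : ℤ) : ℝ) by norm_num, Real.rpow_intCast, zpow_neg]
    rfl
  have hsq (x y : ℝ) : (x ^ 2)⁻¹ * y ^ 2 = y / x * (y / x) := by ring
  have hinv (x y : ℝ) : x⁻¹ * y = y / x := by ring
  simp only [hf.iteratedDeriv_two_snd, hf.iteratedDeriv_two_fst,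
    (hf.hasDerivAt_snd _ _).deriv, (hf.hasDerivAt_fst _ _).deriv, Real.rpow_neg_one, hpow,
    hsq, hinv, sub_mul]
  have h₁ := (ha.isConeTest_derivAlong (0, 1)).integrable_mul_div ha
  have h₂ := (hb.isConeTest_derivAlong (1, 0)).integrable_mul_div ha
  have h₃ := (ha.isConeTest_derivAlong (1, 0)).integrable_mul_div hb
  have hfst := hb.integral_fst_deriv ha
  rw [integral_add h₂ h₃] at hfst
  simp only [hf.derivAlong_comm (1, 0) (0, 1)] at hfst
  have hA := ha.integral_snd_deriv_mul_self
  have hB := hb.integral_snd_deriv_mul_self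
  refine (integral_sub h₁ h₂).trans ?_
  linarith
end

section
/- Let U ⊂ ℝ² (coordinates (τ,r)) be open, let F : U → ℝ be C¹ with F and r ∂_r F bounded on U, and let v be a C^∞ function on ℝ² whose support is a compact subset of U contained in the cone {(τ,r) : r ≥ 0 and −r ≤ τ ≤ r}. Then ∫ r^{−3} F(τ,r) v(τ,r) ∂_r v(τ,r) dτ dr = (1/2) ∫ r^{−4} ( 3 F(τ,r) − r ∂_r F(τ,r) ) v(τ,r)² dτ dr. -/
open MeasureTheory Set

theorem abs_le_mul_of_hasDerivAt_of_zero {f f' : ℝ → ℝ} {K r : ℝ} (hr : 0 ≤ r)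
    (hf : ∀ x, HasDerivAt f (f' x) x) (h0 : f 0 = 0) (hK : ∀ x ∈ Icc 0 r, |f' x| ≤ K) :
    |f r| ≤ K * r := by
  have h := (convex_Icc (0 : ℝ) r).norm_image_sub_le_of_norm_hasDerivWithin_le (f := f) (f' := f')
    (C := K) (fun x _ => (hf x).hasDerivWithinAt) hK (left_mem_Icc.2 hr) (right_mem_Icc.2 hr)
  simpa [h0, abs_of_nonneg hr] using h

theorem hasDerivAt_comp_prodMk_left {f : ℝ × ℝ → ℝ} {t r : ℝ}
    (hf : DifferentiableAt ℝ f (t, r)) :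
    HasDerivAt (fun x => f (t, x)) (fderiv ℝ f (t, r) (0, 1)) r :=
  hf.hasFDerivAt.comp_hasDerivAt r ((hasDerivAt_const r t).prodMk (hasDerivAt_id r))

theorem eq_zero_of_snd_nonpos {u : ℝ × ℝ → ℝ} (hu : Continuous u)
    (hs : tsupport u ⊆ {p : ℝ × ℝ | 0 ≤ p.2}) {p : ℝ × ℝ} (hp : p.2 ≤ 0) : u p = 0 := by
  have h : EqOn (fun r => u (p.1, r)) (fun _ => 0) (Iio 0) := fun r hr =>
    image_eq_zero_of_notMem_tsupport fun hmem => (mem_Iio.1 hr).not_ge (hs hmem)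
  have h' := h.closure (by fun_prop) continuous_const
  rw [closure_Iio] at h'
  exact h' hp

/-- A function vanishing to first order at `r = 0` is bounded by `r ^ 2` and its `r`-derivative
by `r`, up to a constant. -/
theorem exists_bound_of_tsupport_subset {v : ℝ × ℝ → ℝ} (hv : ContDiff ℝ 2 v)
    (hc : HasCompactSupport v) (hs : tsupport v ⊆ {p : ℝ × ℝ | 0 ≤ p.2}) :
    ∃ C : ℝ, 0 ≤ C ∧ ∀ p : ℝ × ℝ, 0 ≤ p.2 →
      |fderiv ℝ v p (0, 1)| ≤ C * p.2 ∧ |v p| ≤ C * p.2 ^ 2 := by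
  set w : ℝ × ℝ → ℝ := fun p => fderiv ℝ v p (0, 1)
  have hwC : ContDiff ℝ 1 w := (hv.fderiv_right (by norm_num)).clm_apply contDiff_const
  have hws : tsupport w ⊆ tsupport v := tsupport_fderiv_apply_subset ℝ (0, 1)
  have hwc : HasCompactSupport w := hc.fderiv_apply ℝ (0, 1)
  obtain ⟨C, hC⟩ := (hwc.fderiv_apply ℝ (0, 1)).exists_bound_of_continuous
    (((hwC.continuous_fderiv one_ne_zero).clm_apply continuous_const))
  have hw_le : ∀ t r : ℝ, 0 ≤ r → |w (t, r)| ≤ C * r := fun t r hr =>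
    abs_le_mul_of_hasDerivAt_of_zero (f := fun x => w (t, x)) hr
      (fun x => hasDerivAt_comp_prodMk_left (hwC.differentiable one_ne_zero _))
      (eq_zero_of_snd_nonpos hwC.continuous (hws.trans hs) le_rfl) fun x _ => hC (t, x)
  have hC0 : 0 ≤ C := (norm_nonneg _).trans (hC 0)
  refine ⟨C, hC0, fun p hp => ⟨hw_le p.1 p.2 hp, ?_⟩⟩
  have := abs_le_mul_of_hasDerivAt_of_zero (f := fun x => v (p.1, x)) (K := C * p.2) hp
    (fun x => hasDerivAt_comp_prodMk_left (hv.differentiable two_ne_zero _))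
    (eq_zero_of_snd_nonpos hv.continuous hs le_rfl)
    fun x hx => (hw_le p.1 x hx.1).trans (mul_le_mul_of_nonneg_left hx.2 hC0)
  calc |v p| ≤ C * p.2 * p.2 := this
    _ = C * p.2 ^ 2 := by ring

theorem integrable_of_continuousOn_of_bounded {X : Type*} [TopologicalSpace X] [MeasurableSpace X]
    [OpensMeasurableSpace X] [SecondCountableTopology X] {μ : Measure X}
    [IsFiniteMeasureOnCompacts μ]
    {G : X → ℝ} {V K : Set X} {C : ℝ} (hV : IsOpen V) (hK : IsCompact K)
    (hG : ContinuousOn G V) (h0 : ∀ p ∉ K ∩ V, G p = 0) (hC : ∀ p ∈ K ∩ V, |G p| ≤ C) :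
    Integrable G μ := by
  have hm : AEStronglyMeasurable G μ := by
    have := hG.aestronglyMeasurable (μ := μ) hV.measurableSet
    rw [← aestronglyMeasurable_indicator_iff hV.measurableSet] at this
    rwa [indicator_eq_self.2 fun p hp => by_contra fun h => hp (h0 p fun h' => h h'.2)] at this
  have hi : IntegrableOn G K μ := by
    refine Measure.integrableOn_of_bounded (M := |C|) hK.measure_lt_top.ne hm
      (ae_of_all _ fun p => ?_)
    by_cases hp : p ∈ K ∩ V
    · exact (hC p hp).trans (le_abs_self C)
    · simp [h0 p hp]
  exact hi.integrable_of_forall_notMem_eq_zero fun p hp => h0 p fun h => hp h.1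

theorem hasDerivAt_inv_pow_three_mul {f g : ℝ → ℝ} {f' g' r : ℝ} (hr : r ≠ 0)
    (hf : HasDerivAt f f' r) (hg : HasDerivAt g g' r) :
    HasDerivAt (fun x => (x ^ 3)⁻¹ * f x * g x ^ 2)
      (2 * ((r ^ 3)⁻¹ * f r * g r * g') - (r ^ 4)⁻¹ * (3 * f r - r * f') * g r ^ 2) r := by
  refine ((((hasDerivAt_pow 3 r).fun_inv (pow_ne_zero 3 hr)).fun_mul hf).fun_mul
    (hg.fun_pow 2)).congr_deriv ?_
  push_cast
  field_simp
  ring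



/-- for `F` a `C¹` function on an open set `U` with `F` and `r ∂_r F` bounded
on `U`, and `v` smooth with compact support contained in `U` and in the cone
`{r ≥ 0, −r ≤ τ ≤ r}` (coordinates `(τ,r) = (p.1, p.2)`):
`∫ r^{−3} F v ∂_r v dτ dr = (1/2) ∫ r^{−4} (3F − r ∂_r F) v² dτ dr`. -/
theorem stmt15 (U : Set (ℝ × ℝ)) (hU : IsOpen U) (F : ℝ × ℝ → ℝ)
    (hF : ContDiffOn ℝ 1 F U)
    (hFbdd : ∃ M : ℝ, ∀ p ∈ U, |F p| ≤ M ∧ |p.2 * deriv (fun r => F (p.1, r)) p.2| ≤ M)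
    (v : ℝ × ℝ → ℝ) (hv : ContDiff ℝ (⊤ : ℕ∞) v) (hc : HasCompactSupport v)
    (hsuppU : tsupport v ⊆ U)
    (hsupp : tsupport v ⊆ {p : ℝ × ℝ | 0 ≤ p.2 ∧ -p.2 ≤ p.1 ∧ p.1 ≤ p.2}) :
    (∫ p in U, p.2 ^ (-3 : ℝ) * F p * v p * deriv (fun r => v (p.1, r)) p.2)
      = (1 / 2) * ∫ p in U,
          p.2 ^ (-4 : ℝ) * (3 * F p - p.2 * deriv (fun r => F (p.1, r)) p.2) * (v p) ^ 2 := by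
  obtain ⟨M, hM⟩ := hFbdd
  have rpow3 : ∀ x : ℝ, x ^ (-3 : ℝ) = (x ^ 3)⁻¹ := fun x => by
    rw [show (-3 : ℝ) = ((-3 : ℤ) : ℝ) by norm_num, Real.rpow_intCast]; rfl
  have rpow4 : ∀ x : ℝ, x ^ (-4 : ℝ) = (x ^ 4)⁻¹ := fun x => by
    rw [show (-4 : ℝ) = ((-4 : ℤ) : ℝ) by norm_num, Real.rpow_intCast]; rfl
  have hs : tsupport v ⊆ {p : ℝ × ℝ | 0 ≤ p.2} := fun p hp => (hsupp hp).1
  have hv2 : ContDiff ℝ 2 v := contDiff_infty.1 hv 2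
  obtain ⟨C, hC0, hC⟩ := exists_bound_of_tsupport_subset hv2 hc hs
  have hvr : ∀ p : ℝ × ℝ, deriv (fun r => v (p.1, r)) p.2 = fderiv ℝ v p (0, 1) := fun p =>
    (hasDerivAt_comp_prodMk_left (hv2.differentiable two_ne_zero p)).deriv
  have hFd : ∀ p ∈ U, DifferentiableAt ℝ F p := fun p hp =>
    (hF.contDiffAt (hU.mem_nhds hp)).differentiableAt one_ne_zero
  have hFr : ∀ p ∈ U, deriv (fun r => F (p.1, r)) p.2 = fderiv ℝ F p (0, 1) := fun p hp =>
    (hasDerivAt_comp_prodMk_left (hFd p hp)).deriv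
  have hFrC : ContinuousOn (fun p : ℝ × ℝ => deriv (fun r => F (p.1, r)) p.2) U :=
    ((hF.continuousOn_fderiv_of_isOpen hU le_rfl).clm_apply continuousOn_const).congr hFr
  have hv0 : ∀ p ∉ tsupport v, v p = 0 := fun p hp => image_eq_zero_of_notMem_tsupport hp
  set V : Set (ℝ × ℝ) := U ∩ {p | 0 < p.2}
  have hVo : IsOpen V := hU.inter (isOpen_lt continuous_const continuous_snd)
  have hvV : ∀ p ∉ tsupport v ∩ V, v p = 0 := fun p hp => by
    by_cases h : p ∈ tsupport v
    · exact eq_zero_of_snd_nonpos hv.continuous hs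
        (not_lt.1 fun h' => hp ⟨h, hsuppU h, h'⟩)
    · exact hv0 p h
  have hne : ∀ n : ℕ, ∀ p ∈ V, p.2 ^ n ≠ 0 := fun n p hp => pow_ne_zero n (ne_of_gt hp.2)
  have hwcont : Continuous fun p => fderiv ℝ v p (0, 1) :=
    (hv2.continuous_fderiv two_ne_zero).clm_apply continuous_const
  set A : ℝ × ℝ → ℝ := fun p => (p.2 ^ 3)⁻¹ * F p * v p * deriv (fun r => v (p.1, r)) p.2 with hA
  set B : ℝ × ℝ → ℝ := fun p => (p.2 ^ 4)⁻¹ *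
    (3 * F p - p.2 * deriv (fun r => F (p.1, r)) p.2) * (v p) ^ 2 with hB
  have hAi : Integrable A := by
    refine integrable_of_continuousOn_of_bounded (C := M * C * C) hVo hc ?_
      (fun p hp => by simp [hA, hvV p hp]) ?_
    · simp only [hA, hvr]
      exact ((((continuous_snd.pow 3).continuousOn.inv₀ (hne 3)).mul
        (hF.continuousOn.mono inter_subset_left)).mul hv.continuous.continuousOn).mul
        hwcont.continuousOn
    · rintro p ⟨-, hpU, hp⟩
      have hp : 0 < p.2 := hp
      obtain ⟨h1, h2⟩ := hC p hp.le
      have h3 := (hM p hpU).1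
      have hM0 : 0 ≤ M := (abs_nonneg _).trans h3
      simp only [hA, hvr, abs_mul, abs_inv, abs_pow, abs_of_pos hp]
      calc (p.2 ^ 3)⁻¹ * |F p| * |v p| * |fderiv ℝ v p (0, 1)|
          ≤ (p.2 ^ 3)⁻¹ * M * (C * p.2 ^ 2) * (C * p.2) := by gcongr
        _ = M * C * C := by field_simp
  have hBi : Integrable B := by
    refine integrable_of_continuousOn_of_bounded (C := 4 * M * C ^ 2) hVo hc ?_
      (fun p hp => by simp [hB, hvV p hp]) ?_
    · exact (((continuous_snd.pow 4).continuousOn.inv₀ (hne 4)).mul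
        ((continuousOn_const.mul (hF.continuousOn.mono inter_subset_left)).sub
          (continuousOn_snd.mul (hFrC.mono inter_subset_left)))).mul
        (hv.continuous.pow 2).continuousOn
    · rintro p ⟨-, hpU, hp⟩
      have hp : 0 < p.2 := hp
      obtain ⟨-, h2⟩ := hC p hp.le
      obtain ⟨h3, h4⟩ := hM p hpU
      have hM0 : 0 ≤ M := (abs_nonneg _).trans h3
      have h5 : |3 * F p - p.2 * deriv (fun r => F (p.1, r)) p.2| ≤ 4 * M := by
        rw [abs_le] at *
        constructor <;> linarith
      calc |B p| = (p.2 ^ 4)⁻¹ * |3 * F p - p.2 * deriv (fun r => F (p.1, r)) p.2| * |v p| ^ 2 := by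
            simp only [hB, abs_mul, abs_inv, abs_pow, abs_of_pos hp]
        _ ≤ (p.2 ^ 4)⁻¹ * (4 * M) * (C * p.2 ^ 2) ^ 2 := by gcongr
        _ = 4 * M * C ^ 2 := by field_simp
  have hDi : Integrable (fun p => 2 * A p - B p) (volume.prod volume) := (hAi.const_mul 2).sub hBi
  have hslice : ∀ᵐ t : ℝ, ∫ r : ℝ, (2 * A (t, r) - B (t, r)) = 0 := by
    filter_upwards [hDi.prod_right_ae, Measure.ae_ne volume (0 : ℝ)] with t hint ht
    have hderiv : ∀ r : ℝ, HasDerivAt (fun x => (x ^ 3)⁻¹ * F (t, x) * v (t, x) ^ 2)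
        (2 * A (t, r) - B (t, r)) r := by
      intro r
      by_cases hr : (t, r) ∈ tsupport v
      · have hr0 : r ≠ 0 := by
          rintro rfl
          obtain ⟨-, h1, h2⟩ := hsupp hr
          exact ht (le_antisymm h2 (by simpa using h1))
        exact hasDerivAt_inv_pow_three_mul hr0
          (hasDerivAt_comp_prodMk_left (hFd _ (hsuppU hr))).differentiableAt.hasDerivAt
          (hasDerivAt_comp_prodMk_left
            (hv2.differentiable two_ne_zero _)).differentiableAt.hasDerivAt
      · have hz : 2 * A (t, r) - B (t, r) = 0 := by simp [hA, hB, hv0 _ hr]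
        rw [hz]
        refine (hasDerivAt_const r (0 : ℝ)).congr_of_eventuallyEq ?_
        have : ∀ᶠ x in nhds r, (t, x) ∉ tsupport v :=
          (Continuous.prodMk_right t).continuousAt.eventually
            ((isClosed_tsupport v).isOpen_compl.mem_nhds hr)
        filter_upwards [this] with x hx
        simp [hv0 _ hx]
    refine integral_eq_zero_of_hasDerivAt_of_integrable hderiv hint ?_
    refine Continuous.integrable_of_hasCompactSupport
      (continuous_iff_continuousAt.2 fun r => (hderiv r).continuousAt) ?_
    refine HasCompactSupport.intro (hc.isCompact.image continuous_snd) fun x hx => ?_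
    simp [hv0 (t, x) fun h => hx ⟨_, h, rfl⟩]
  have htot : ∫ p, (2 * A p - B p) = 0 := by
    rw [Measure.volume_eq_prod, integral_prod _ hDi, integral_congr_ae hslice, integral_zero]
  rw [integral_sub (hAi.const_mul 2) hBi, integral_const_mul] at htot
  have hvU : ∀ p ∉ U, v p = 0 := fun p hp => hv0 p fun h => hp (hsuppU h)
  simp only [rpow3, rpow4]
  rw [setIntegral_eq_integral_of_forall_compl_eq_zero (fun p hp => by simp [hvU p hp]),
    setIntegral_eq_integral_of_forall_compl_eq_zero (fun p hp => by simp [hvU p hp])]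
  linarith
end

section
/- Let T > 0, let F be a C^∞ function on an open neighborhood of the closed square [0,T]×[0,T] in ℝ² (coordinates (μ,ν)), and let w be a C^∞ function on the same neighborhood such that: (i) all partial derivatives of w (of all orders, including w itself) vanish at every point of ({0}×[0,T]) ∪ ([0,T]×{0}); and (ii) (μ+ν)² ∂_μ∂_ν w(μ,ν) + F(μ,ν) w(μ,ν) = 0 for all (μ,ν) ∈ [0,T]×[0,T]. Then w(μ,ν) = 0 for every (μ,ν) ∈ [0,T]×[0,T] with (μ+ν)² + (ν−μ)² ≤ T²/16. -/
open MeasureTheory Set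

/-- A function all of whose derivatives vanish on the two lower edges of a square vanishes there,
with all its derivatives, to every finite order in the distance to these edges. -/
lemma exists_norm_iteratedFDeriv_le_min_pow {T : ℝ} {V : Set (ℝ × ℝ)} (hV : IsOpen V)
    (hVsq : Icc (0 : ℝ) T ×ˢ Icc (0 : ℝ) T ⊆ V) {w : ℝ × ℝ → ℝ}
    (hw : ContDiffOn ℝ (⊤ : ℕ∞) w V)
    (hvanish : ∀ p ∈ (({0} : Set ℝ) ×ˢ Icc (0 : ℝ) T) ∪ (Icc (0 : ℝ) T ×ˢ ({0} : Set ℝ)),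
      ∀ n : ℕ, iteratedFDeriv ℝ n w p = 0) (n k : ℕ) :
    ∃ C, 0 ≤ C ∧ ∀ p ∈ Icc (0 : ℝ) T ×ˢ Icc (0 : ℝ) T,
      ‖iteratedFDeriv ℝ k w p‖ ≤ C * min p.1 p.2 ^ n := by
  have hat : ∀ p ∈ Icc (0 : ℝ) T ×ˢ Icc (0 : ℝ) T, ∀ k : ℕ,
      DifferentiableAt ℝ (iteratedFDeriv ℝ k w) p := fun p hp k =>
    (hw.contDiffAt (hV.mem_nhds (hVsq hp))).differentiableAt_iteratedFDeriv
      (by exact_mod_cast WithTop.coe_lt_top k)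
  induction n generalizing k with
  | zero =>
    have hc : ContinuousOn (iteratedFDeriv ℝ k w) (Icc (0 : ℝ) T ×ˢ Icc (0 : ℝ) T) :=
      fun p hp => (hat p hp k).continuousAt.continuousWithinAt
    obtain ⟨C, hC⟩ := (isCompact_Icc.prod isCompact_Icc).exists_bound_of_continuousOn hc
    exact ⟨max C 0, le_max_right _ _, fun p hp => by simpa using Or.inl (hC p hp)⟩
  | succ n ih =>
    obtain ⟨C, hC0, hC⟩ := ih (k + 1)
    refine ⟨C, hC0, ?_⟩
    rintro ⟨a, b⟩ hp
    obtain ⟨⟨ha0, haT⟩, hb0, hbT⟩ := id hp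
    simp only at ha0 haT hb0 hbT ⊢
    have hm : 0 ≤ min a b := le_min ha0 hb0
    have hsub : ∀ q ∈ Icc (0 : ℝ × ℝ) (a, b), q ∈ Icc (0 : ℝ) T ×ˢ Icc (0 : ℝ) T :=
      fun q hq => ⟨⟨hq.1.1, hq.2.1.trans haT⟩, hq.1.2, hq.2.2.trans hbT⟩
    have key : ∀ q ∈ Icc (0 : ℝ × ℝ) (a, b),
        ‖fderiv ℝ (iteratedFDeriv ℝ k w) q‖ ≤ C * min a b ^ n := fun q hq => by
      rw [norm_fderiv_iteratedFDeriv]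
      refine (hC q (hsub q hq)).trans ?_
      have h0 : 0 ≤ min q.1 q.2 := le_min hq.1.1 hq.1.2
      have h1 : min q.1 q.2 ≤ min a b := min_le_min hq.2.1 hq.2.2
      gcongr
    obtain ⟨q, hq, hq0, hd⟩ : ∃ q ∈ Icc (0 : ℝ × ℝ) (a, b), iteratedFDeriv ℝ k w q = 0 ∧
        ‖(a, b) - q‖ = min a b := by
      rcases le_total a b with h | h
      · exact ⟨(0, b), ⟨⟨le_rfl, hb0⟩, ha0, le_rfl⟩,
          hvanish (0, b) (Or.inl ⟨rfl, hb0, hbT⟩) k, by simp [Prod.norm_def, h, ha0, abs_of_nonneg]⟩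
      · exact ⟨(a, 0), ⟨⟨ha0, le_rfl⟩, le_rfl, hb0⟩,
          hvanish (a, 0) (Or.inr ⟨⟨ha0, haT⟩, rfl⟩) k, by simp [Prod.norm_def, h, hb0, abs_of_nonneg]⟩
    have := (convex_Icc (0 : ℝ × ℝ) (a, b)).norm_image_sub_le_of_norm_fderiv_le
      (fun q hq => hat q (hsub q hq) k) key hq ⟨⟨ha0, hb0⟩, le_rfl⟩
    rw [hq0, sub_zero, hd] at this
    rwa [pow_succ, ← mul_assoc]

/-- A function vanishing at `0` whose derivative is bounded by `K x ^ n` is bounded by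
`K x ^ (n + 1) / (n + 1)`. -/
lemma abs_le_pow_succ_div_of_abs_deriv_le {f f' : ℝ → ℝ} {K x : ℝ} {n : ℕ} (hx : 0 ≤ x)
    (hf0 : f 0 = 0) (hf : ∀ t ∈ Icc 0 x, HasDerivAt f (f' t) t)
    (hb : ∀ t ∈ Icc 0 x, |f' t| ≤ K * t ^ n) :
    |f x| ≤ K * (x ^ (n + 1) / (n + 1)) := by
  refine image_norm_le_of_norm_deriv_right_le_deriv_boundary (f := f) (f' := f')
    (B := fun t => K * (t ^ (n + 1) / (n + 1))) (B' := fun t => K * t ^ n)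
    (fun t ht => (hf t ht).continuousAt.continuousWithinAt)
    (fun t ht => (hf t (Ico_subset_Icc_self ht)).hasDerivWithinAt) (by simp [hf0])
    (fun t => ?_) (fun t ht => hb t (Ico_subset_Icc_self ht)) ⟨hx, le_rfl⟩
  have h := ((hasDerivAt_pow (n + 1) t).div_const ((n : ℝ) + 1)).const_mul K
  have hn : (n : ℝ) + 1 ≠ 0 := by positivity
  rwa [Nat.add_sub_cancel, Nat.cast_add_one, mul_div_cancel_left₀ _ hn] at h

/-- unique continuation near the corner. If `w` and `F` are `C^∞` on an open
neighborhood `V` of the closed square `[0,T]×[0,T]`, all partial derivatives of `w` (of all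
orders, including `w` itself) vanish on `({0}×[0,T]) ∪ ([0,T]×{0})`, and
`(μ+ν)² ∂_μ∂_ν w + F w = 0` on `[0,T]×[0,T]`, then `w = 0` on the part of the square where
`(μ+ν)² + (ν−μ)² ≤ T²/16`. -/
theorem stmt16 (T : ℝ) (hT : 0 < T) (V : Set (ℝ × ℝ)) (hV : IsOpen V)
    (hVsq : Icc (0 : ℝ) T ×ˢ Icc (0 : ℝ) T ⊆ V)
    (F w : ℝ × ℝ → ℝ) (hF : ContDiffOn ℝ (⊤ : ℕ∞) F V) (hw : ContDiffOn ℝ (⊤ : ℕ∞) w V)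
    (hvanish : ∀ p ∈ (({0} : Set ℝ) ×ˢ Icc (0 : ℝ) T) ∪ (Icc (0 : ℝ) T ×ˢ ({0} : Set ℝ)),
      ∀ n : ℕ, iteratedFDeriv ℝ n w p = 0)
    (heq : ∀ p ∈ Icc (0 : ℝ) T ×ˢ Icc (0 : ℝ) T,
      (p.1 + p.2) ^ 2 * deriv (fun μ => deriv (fun ν => w (μ, ν)) p.2) p.1 + F p * w p = 0) :
    ∀ p ∈ Icc (0 : ℝ) T ×ˢ Icc (0 : ℝ) T,
      (p.1 + p.2) ^ 2 + (p.2 - p.1) ^ 2 ≤ T ^ 2 / 16 → w p = 0 := by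
  obtain ⟨M, hM⟩ := (isCompact_Icc.prod isCompact_Icc).exists_bound_of_continuousOn
    (hF.continuousOn.mono hVsq)
  have hM0 : 0 ≤ M := (norm_nonneg _).trans (hM (0, 0) ⟨⟨le_rfl, hT.le⟩, le_rfl, hT.le⟩)
  obtain ⟨n, hn⟩ := exists_nat_ge M
  have hMn : M ≤ 2 * ((n : ℝ) + 1) ^ 2 := by nlinarith [(Nat.cast_nonneg n : (0 : ℝ) ≤ n)]
  set v : ℝ × ℝ → ℝ := fun p => fderiv ℝ w p (0, 1) with hv
  have hwν : ∀ p ∈ V, HasDerivAt (fun ν => w (p.1, ν)) (v p) p.2 := fun p hp => by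
    have h : HasFDerivAt w (fderiv ℝ w p) (p.1, p.2) :=
      ((hw.contDiffAt (hV.mem_nhds hp)).differentiableAt (by simp)).hasFDerivAt
    exact h.comp_hasDerivAt p.2 ((hasDerivAt_const p.2 p.1).prodMk (hasDerivAt_id p.2))
  have hvμ : ∀ p ∈ V, HasDerivAt (fun μ => v (μ, p.2))
      (deriv (fun μ => deriv (fun ν => w (μ, ν)) p.2) p.1) p.1 := fun p hp => by
    have hd : DifferentiableAt ℝ v (p.1, p.2) :=
      (((hw.contDiffAt (hV.mem_nhds hp)).fderiv_right (m := 1) (by norm_cast)).differentiableAt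
        (by simp)).clm_apply (differentiableAt_const _)
    have hc : ContinuousAt (fun μ : ℝ => (μ, p.2)) p.1 := by fun_prop
    have he : (fun μ => deriv (fun ν => w (μ, ν)) p.2) =ᶠ[nhds p.1] fun μ => v (μ, p.2) := by
      filter_upwards [hc.preimage_mem_nhds (hV.mem_nhds hp)] with μ hμ
      exact (hwν (μ, p.2) hμ).deriv
    rw [he.deriv_eq]
    have hμ : DifferentiableAt ℝ (fun μ : ℝ => (μ, p.2)) p.1 := by fun_prop
    exact (hd.comp p.1 hμ).hasDerivAt
  have hw0 : ∀ p ∈ (({0} : Set ℝ) ×ˢ Icc (0 : ℝ) T) ∪ (Icc (0 : ℝ) T ×ˢ ({0} : Set ℝ)),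
      w p = 0 := fun p hp => by
    rw [← norm_eq_zero, ← norm_iteratedFDeriv_zero (𝕜 := ℝ), hvanish p hp 0, norm_zero]
  have hv0 : ∀ p ∈ (({0} : Set ℝ) ×ˢ Icc (0 : ℝ) T) ∪ (Icc (0 : ℝ) T ×ˢ ({0} : Set ℝ)),
      v p = 0 := fun p hp => by
    have : fderiv ℝ w p = 0 := by
      rw [← norm_eq_zero, ← norm_iteratedFDeriv_one, hvanish p hp 1, norm_zero]
    simp [hv, this]
  have contraction : ∀ A : ℝ,
      (∀ p ∈ Icc (0 : ℝ) T ×ˢ Icc (0 : ℝ) T, |w p| ≤ A * (p.1 * p.2) ^ (n + 1)) →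
      ∀ p ∈ Icc (0 : ℝ) T ×ˢ Icc (0 : ℝ) T, |w p| ≤ A / 2 * (p.1 * p.2) ^ (n + 1) := by
    intro A hA
    have hA0 : 0 ≤ A := by
      have := (abs_nonneg _).trans (hA (T, T) ⟨⟨hT.le, le_rfl⟩, hT.le, le_rfl⟩)
      exact nonneg_of_mul_nonneg_left this (by positivity)
    have hvμν : ∀ a ∈ Icc (0 : ℝ) T, ∀ b ∈ Icc (0 : ℝ) T, 0 < b →
        |deriv (fun μ => deriv (fun ν => w (μ, ν)) b) a| ≤ M * A / 4 * b ^ n * a ^ n := by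
      intro a ha b hb hb0
      have h1 := heq (a, b) ⟨ha, hb⟩
      simp only at h1
      have hF' : |F (a, b)| ≤ M := hM (a, b) ⟨ha, hb⟩
      have ha0 := ha.1
      have hpos : 0 < (a + b) ^ 2 := by positivity
      refine le_of_mul_le_mul_left ?_ hpos
      calc (a + b) ^ 2 * |deriv (fun μ => deriv (fun ν => w (μ, ν)) b) a|
          = |(a + b) ^ 2 * deriv (fun μ => deriv (fun ν => w (μ, ν)) b) a| := by
            rw [abs_mul, abs_of_pos hpos]
        _ = |F (a, b)| * |w (a, b)| := by
            rw [eq_neg_of_add_eq_zero_left h1, abs_neg, abs_mul]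
        _ ≤ M * (A * (a * b) ^ (n + 1)) := by
            gcongr
            exact hA (a, b) ⟨ha, hb⟩
        _ = M * A / 4 * (a * b) ^ n * (4 * (a * b)) := by ring
        _ ≤ M * A / 4 * (a * b) ^ n * (a + b) ^ 2 := by
            gcongr
            nlinarith [sq_nonneg (a - b)]
        _ = (a + b) ^ 2 * (M * A / 4 * b ^ n * a ^ n) := by rw [mul_pow]; ring
    have hvle : ∀ a ∈ Icc (0 : ℝ) T, ∀ b ∈ Icc (0 : ℝ) T,
        |v (a, b)| ≤ M * A / 4 * (a ^ (n + 1) / (n + 1)) * b ^ n := by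
      intro a ha b hb
      rcases hb.1.eq_or_lt with rfl | hb0
      · have ha0 := ha.1
        rw [hv0 (a, 0) (Or.inr ⟨ha, rfl⟩), abs_zero]
        positivity
      · have hsq : ∀ t ∈ Icc 0 a, t ∈ Icc 0 T := fun t ht => ⟨ht.1, ht.2.trans ha.2⟩
        refine (abs_le_pow_succ_div_of_abs_deriv_le (f := fun μ => v (μ, b)) ha.1
          (hv0 (0, b) (Or.inl ⟨rfl, hb⟩))
          (fun t ht => hvμ (t, b) (hVsq ⟨hsq t ht, hb⟩))
          (fun t ht => hvμν t (hsq t ht) b hb hb0)).trans_eq ?_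
        ring
    rintro ⟨a, b⟩ ⟨ha, hb⟩
    simp only at ha hb ⊢
    have hsq : ∀ t ∈ Icc 0 b, t ∈ Icc 0 T := fun t ht => ⟨ht.1, ht.2.trans hb.2⟩
    have ha0 := ha.1
    have hb0 := hb.1
    calc |w (a, b)| ≤ M * A / 4 * (a ^ (n + 1) / (n + 1)) * (b ^ (n + 1) / (n + 1)) :=
          abs_le_pow_succ_div_of_abs_deriv_le (f := fun ν => w (a, ν)) hb0
            (hw0 (a, 0) (Or.inr ⟨ha, rfl⟩))
            (fun t ht => hwν (a, t) (hVsq ⟨ha, hsq t ht⟩)) (fun t ht => hvle a ha t (hsq t ht))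
      _ = M / (2 * ((n : ℝ) + 1) ^ 2) * (A / 2 * (a * b) ^ (n + 1)) := by
          rw [mul_pow]; field_simp; ring
      _ ≤ 1 * (A / 2 * (a * b) ^ (n + 1)) := by
          gcongr
          exact div_le_one_of_le₀ hMn (by positivity)
      _ = A / 2 * (a * b) ^ (n + 1) := one_mul _
  obtain ⟨C, hC0, hC⟩ := exists_norm_iteratedFDeriv_le_min_pow hV hVsq hw hvanish (2 * (n + 1)) 0
  have hiter : ∀ j : ℕ, ∀ p ∈ Icc (0 : ℝ) T ×ˢ Icc (0 : ℝ) T,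
      |w p| ≤ C / 2 ^ j * (p.1 * p.2) ^ (n + 1) := by
    intro j
    induction j with
    | zero =>
      intro p hp
      have h := hC p hp
      rw [norm_iteratedFDeriv_zero, pow_mul] at h
      refine h.trans ?_
      have h0 : 0 ≤ min p.1 p.2 := le_min hp.1.1 hp.2.1
      have h1 : min p.1 p.2 ^ 2 ≤ p.1 * p.2 := by
        rw [sq]
        exact mul_le_mul (min_le_left _ _) (min_le_right _ _) h0 hp.1.1
      rw [pow_zero, div_one]
      gcongr
    | succ j ih =>
      rw [pow_succ, ← div_div]
      exact contraction _ ih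
  intro p hp _
  have hlim : Filter.Tendsto (fun j : ℕ => C / 2 ^ j * (p.1 * p.2) ^ (n + 1)) Filter.atTop
      (nhds 0) := by
    have h := ((tendsto_pow_atTop_nhds_zero_of_lt_one (r := (1 / 2 : ℝ)) (by norm_num)
      (by norm_num)).const_mul C).mul_const ((p.1 * p.2) ^ (n + 1))
    simpa [div_eq_mul_inv] using h
  exact abs_nonpos_iff.1 (ge_of_tendsto' hlim fun j => hiter j p hp)
end
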